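/- arXiv:1601.06218 — 6 statements merged into one kernel-verified Lean document; each statement's English description precedes it below -/
import Mathlib

section
/- There exist a surjective map φ: ℕ → F₂ and a sequence of positive real numbers (a_n)_{n∈ℕ} such that: (i) ∑_{n ∈ φ⁻¹(s)} a_n = 1 for every s ∈ F₂; (ii) for every x ∈ C*_r(F₂) the series ∑_{n=1}^∞ a_n δ_{φ(n)}(x) λ_{φ(n)} converges in operator norm to x; and (iii) the partial-sum operators S_m(x) = ∑_{n=1}^m a_n δ_{φ(n)}(x) λ_{φ(n)} on C*_r(F₂) satisfy sup_m ‖S_m‖_cb < ∞. That is, (λ_{φ(n)}, a_n δ_{φ(n)}) is a cb-frame for C*_r(F₂) derived from an infinite convex decomposition of the biorthogonal system (λ_s, δ_s)_{s∈F₂}. -/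
noncomputable section

open Filter
open scoped ENNReal

/-- The free group on two generators. -/
abbrev G2 : Type := FreeGroup (Fin 2)

/-- The word length of an element of `F₂`, i.e. the length of its reduced word. -/
def wlen (s : G2) : ℕ := (FreeGroup.toWord s).length

/-- The Hilbert space `ℓ²(F₂)`. -/
abbrev H2 : Type := lp (fun _ : G2 => ℂ) 2

lemma memℓp_translate (s : G2) (ξ : H2) : Memℓp (fun t => ξ (s⁻¹ * t)) 2 := by
  have h : Summable fun t : G2 => ‖ξ t‖ ^ (2 : ℝ≥0∞).toReal :=
    (memℓp_gen_iff (by norm_num)).1 (lp.memℓp ξ)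
  refine memℓp_gen ?_
  exact ((Equiv.mulLeft (s⁻¹ : G2)).summable_iff
    (f := fun t : G2 => ‖ξ t‖ ^ (2 : ℝ≥0∞).toReal)).2 h

/-- The left regular representation of `F₂` on `ℓ²(F₂)`: `(λ_s ξ)(t) = ξ(s⁻¹ t)`,
as a bounded operator. -/
def lam (s : G2) : H2 →L[ℂ] H2 :=
  LinearMap.mkContinuous
    { toFun := fun ξ => ⟨fun t => ξ (s⁻¹ * t), memℓp_translate s ξ⟩
      map_add' := by
        intro ξ η
        apply Subtype.ext
        funext t
        rfl
      map_smul' := by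
        intro c ξ
        apply Subtype.ext
        funext t
        rfl }
    1
    (by
      intro ξ
      have h2 : (0:ℝ) < (2 : ℝ≥0∞).toReal := by norm_num
      rw [one_mul]
      apply le_of_eq
      rw [lp.norm_eq_tsum_rpow h2, lp.norm_eq_tsum_rpow h2]
      congr 1
      exact (Equiv.mulLeft (s⁻¹ : G2)).tsum_eq
        (f := fun t : G2 => ‖ξ t‖ ^ (2 : ℝ≥0∞).toReal))

/-- The reduced free group C*-algebra `C*_r(F₂)`, realized as the operator-norm closure of
`span{λ_s : s ∈ F₂}` inside `B(ℓ²(F₂))`. -/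
def CrF2 : Submodule ℂ (H2 →L[ℂ] H2) :=
  (Submodule.span ℂ (Set.range lam)).topologicalClosure

lemma lam_mem_CrF2 (s : G2) : lam s ∈ CrF2 :=
  Submodule.le_topologicalClosure _ (Submodule.subset_span ⟨s, rfl⟩)

/-- `λ_s` as an element of `C*_r(F₂)`. -/
def lamCr (s : G2) : CrF2 := ⟨lam s, lam_mem_CrF2 s⟩

/-- The vector `δ_s ∈ ℓ²(F₂)`. -/
def deltaVec (s : G2) : H2 := lp.single 2 s 1

/-- The functional `δ_s : x ↦ ⟨x δ_e, δ_s⟩` on `B(ℓ²(F₂))`. -/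
def deltaFn (s : G2) : (H2 →L[ℂ] H2) →L[ℂ] ℂ :=
  (innerSL ℂ (deltaVec s)).comp (ContinuousLinearMap.apply ℂ H2 (deltaVec 1))

/-- The functional `δ_s` restricted to `C*_r(F₂)`. -/
def deltaCr (s : G2) : CrF2 →L[ℂ] ℂ := (deltaFn s).comp CrF2.subtypeL

/-- The amplification sending an `n × n` matrix of bounded operators on `ℓ²(F₂)` to the
corresponding bounded operator on the `ℓ²`-direct sum of `n` copies of `ℓ²(F₂)`; this realizes
the C*-norm on `Mₙ(B(ℓ²(F₂)))`. -/
def matOp {n : ℕ} (M : Matrix (Fin n) (Fin n) (H2 →L[ℂ] H2)) :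
    PiLp 2 (fun _ : Fin n => H2) →L[ℂ] PiLp 2 (fun _ : Fin n => H2) :=
  (((PiLp.continuousLinearEquiv 2 ℂ (fun _ : Fin n => H2)).symm :
      (∀ _ : Fin n, H2) →L[ℂ] PiLp 2 (fun _ : Fin n => H2)).comp
    (ContinuousLinearMap.pi (fun i => ∑ j, (M i j).comp (ContinuousLinearMap.proj j)))).comp
    ((PiLp.continuousLinearEquiv 2 ℂ (fun _ : Fin n => H2)) :
      PiLp 2 (fun _ : Fin n => H2) →L[ℂ] (∀ _ : Fin n, H2))

/-- The norm of an `n × n` matrix over `C*_r(F₂)`, i.e. the norm in `Mₙ(C*_r(F₂)) ⊆ Mₙ(B(ℓ²))`. -/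
def matNorm {n : ℕ} (u : Matrix (Fin n) (Fin n) CrF2) : ℝ :=
  ‖matOp (fun i j => (u i j : H2 →L[ℂ] H2))‖

/-- The partial-sum operators `S_m(x) = ∑_{n<m} a_n δ_{φ(n)}(x) λ_{φ(n)}` on `C*_r(F₂)`. -/
def frameOp (φ : ℕ → G2) (a : ℕ → ℝ) (m : ℕ) : CrF2 →L[ℂ] CrF2 :=
  ∑ n ∈ Finset.range m, ((a n : ℂ) • deltaCr (φ n)).smulRight (lamCr (φ n))

end

namespace CbFrame

open FreeGroup Filter Topology

lemma replicate_suffix_reduce {α : Type*} [DecidableEq α] (b : α × Bool) (n : ℕ) (L : List (α × Bool)) :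
    List.replicate (n - L.length) b <:+ reduce (L ++ List.replicate n b) := by
  induction L with
  | nil => simp [reduce_replicate]
  | cons x L ih =>
    have hlen : n - (x :: L).length = n - L.length - 1 := by simp; omega
    have hshort : List.replicate (n - (x :: L).length) b <:+
        (List.replicate (n - L.length) b).tail := by
      rw [hlen, List.tail_replicate]
    have hmono : List.replicate (n - (x :: L).length) b <:+ List.replicate (n - L.length) b :=
      hshort.trans (List.tail_suffix _)
    rw [List.cons_append, reduce.cons]
    generalize reduce (L ++ List.replicate n b) = W at ih
    cases W with
    | nil =>
      rw [List.suffix_nil] at ih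
      rw [ih] at hmono
      rw [List.suffix_nil.1 hmono]
      exact List.nil_suffix
    | cons y W =>
      dsimp only
      split_ifs
      · rcases List.suffix_cons_iff.1 ih with h | h
        · rw [h] at hshort
          exact hshort
        · exact hmono.trans h
      · exact hmono.trans (ih.trans (List.suffix_cons _ _))

/-- Two lists have a longest common suffix. -/
lemma exists_longest_common_suffix {α : Type*} (U V : List α) :
    ∃ U' V' R : List α, U = U' ++ R ∧ V = V' ++ R ∧ (∀ z, z <:+ U → z <:+ V → z <:+ R) := by
  classical
  let P : ℕ → Prop := fun n => ∃ R : List α, R.length = n ∧ R <:+ U ∧ R <:+ V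
  have h0 : P 0 := ⟨[], rfl, List.nil_suffix, List.nil_suffix⟩
  obtain ⟨R, hn, ⟨U', hU⟩, ⟨V', hV⟩⟩ := Nat.findGreatest_spec (Nat.zero_le U.length) h0
  refine ⟨U', V', R, hU.symm, hV.symm, fun z hzU hzV => ?_⟩
  refine List.suffix_of_suffix_length_le hzU ⟨U', hU⟩ ?_
  rw [hn]
  exact Nat.le_findGreatest hzU.length_le ⟨z, rfl, hzU, hzV⟩

lemma norm_mul_inv_of_longest {α : Type*} [DecidableEq α] {s t : FreeGroup α}
    {U V R : List (α × Bool)}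
    (hs : s.toWord = U ++ R) (ht : t.toWord = V ++ R)
    (hR : ∀ z, z <:+ s.toWord → z <:+ t.toWord → z <:+ R) :
    (t * s⁻¹).toWord.length = U.length + V.length := by
  have hsr : IsReduced (U ++ R) := hs ▸ isReduced_toWord
  have htr : IsReduced (V ++ R) := ht ▸ isReduced_toWord
  have hU : IsReduced U := (List.isChain_append.1 hsr).1
  have hV : IsReduced V := (List.isChain_append.1 htr).1
  have hUi : IsReduced (invRev U) := by
    rw [isReduced_iff_reduce_eq, reduce_invRev, hU.reduce_eq]
  have hmul : t * s⁻¹ = mk (V ++ invRev U) := by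
    rw [← mk_toWord (x := t), ← mk_toWord (x := s), hs, ht, ← mul_mk, ← mul_mk, ← mul_mk,
      ← inv_mk]
    group
  have hred : IsReduced (V ++ invRev U) := by
    refine List.isChain_append.2 ⟨hV, hUi, fun x hx y hy hxy => ?_⟩
    obtain ⟨V₀, rfl⟩ := List.getLast?_eq_some_iff.1 hx
    rcases List.eq_nil_or_concat' U with rfl | ⟨U₀, z, rfl⟩
    · simp at hy
    · have hy' : y = (z.1, !z.2) := by
        simpa [invRev, eq_comm] using hy
      subst hy'
      by_contra hne
      have hxz : x = z := by
        refine Prod.ext hxy ?_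
        revert hne
        cases x.2 <;> cases z.2 <;> simp
      subst hxz
      have := (hR (x :: R) ⟨U₀, by simp [hs]⟩ ⟨V₀, by simp [ht]⟩).length_le
      simp at this
  rw [hmul, toWord_mk, hred.reduce_eq]
  simp [add_comm]

/-- The sequence `0, 1, 2, 4, 6, 9, 12, …`. -/
def tri (n : ℕ) : ℕ := (n + 1) ^ 2 / 4

lemma tri_zero : tri 0 = 0 := rfl

lemma tri_add_two (n : ℕ) : tri (n + 2) = tri n + (n + 2) := by
  unfold tri
  have : (n + 2 + 1) ^ 2 = (n + 1) ^ 2 + 4 * (n + 2) := by ring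
  omega

lemma tri_succ (n : ℕ) : tri (n + 1) = tri n + (n / 2 + 1) := by
  induction n using Nat.twoStepInduction with
  | zero => rfl
  | one => rfl
  | more n ih _ =>
    rw [show n + 2 + 1 = n + 1 + 2 by ring, tri_add_two, tri_add_two, ih]
    omega

lemma tri_pos {n : ℕ} (hn : 0 < n) : 0 < tri n := by
  obtain ⟨m, rfl⟩ := Nat.exists_eq_succ_of_ne_zero hn.ne'
  rw [Nat.succ_eq_add_one, tri_succ]; omega

lemma le_four_mul_tri (n : ℕ) : n * (n + 2) ≤ 4 * tri n := by
  induction n using Nat.twoStepInduction with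
  | zero => simp
  | one => decide
  | more n ih _ => rw [tri_add_two]; nlinarith

lemma four_mul_tri_le (n : ℕ) : 4 * tri n ≤ (n + 1) ^ 2 := Nat.mul_div_le _ _

lemma tri_mono : Monotone tri := monotone_nat_of_le_succ fun n => by rw [tri_succ]; omega

lemma sum_sub_two_mul (n : ℕ) : ∀ m, n ≤ m → ∑ e ∈ Finset.range m, (n - 2 * e) = tri n := by
  induction n using Nat.twoStepInduction with
  | zero => simp [tri_zero]
  | one =>
    intro m hm
    obtain ⟨m, rfl⟩ := Nat.exists_eq_add_of_le' hm
    rw [Finset.sum_range_succ', Finset.sum_eq_zero (fun i _ => by omega)]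
    rfl
  | more n ih _ =>
    intro m hm
    obtain ⟨m, rfl⟩ := Nat.exists_eq_add_of_le' (show 1 ≤ m by omega)
    rw [Finset.sum_range_succ', tri_add_two, ← ih m (by omega)]
    congr 1
    exact Finset.sum_congr rfl fun i _ => by omega

/-- The ratios `tri (n + 1) / tri n` decrease. -/
lemma tri_mul_tri_succ_le {n N : ℕ} (h : n ≤ N) : tri n * tri (N + 1) ≤ tri (n + 1) * tri N := by
  have key : ∀ k, tri k * ((k + 1) / 2 + 1) ≤ tri (k + 1) * (k / 2 + 1) := by
    intro k
    have h1 := four_mul_tri_le k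
    rw [tri_succ]
    rcases Nat.even_or_odd' k with ⟨j, rfl | rfl⟩
    · have e1 : (2 * j + 1) / 2 = j := by omega
      have e2 : 2 * j / 2 = j := by omega
      rw [e1, e2]; nlinarith
    · have e1 : (2 * j + 1 + 1) / 2 = j + 1 := by omega
      have e2 : (2 * j + 1) / 2 = j := by omega
      rw [e1, e2]
      nlinarith
  have step : ∀ k, tri k * tri (k + 2) ≤ tri (k + 1) * tri (k + 1) := by
    intro k
    have := key k
    rw [tri_succ (k + 1)]
    nlinarith [tri_succ k]
  induction N, h using Nat.le_induction with
  | base => rw [mul_comm]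
  | succ N hN ih =>
    rcases Nat.eq_zero_or_pos N with rfl | hpos
    · obtain rfl : n = 0 := by omega
      simp [tri_zero]
    have hp : 0 < tri N := tri_pos hpos
    have hp' : 0 < tri (N + 1) := tri_pos (by omega)
    have h2 := step N
    refine Nat.le_of_mul_le_mul_left ?_ hp
    calc tri N * (tri n * tri (N + 1 + 1)) = tri n * (tri N * tri (N + 2)) := by ring
      _ ≤ tri n * (tri (N + 1) * tri (N + 1)) := by gcongr
      _ = tri n * tri (N + 1) * tri (N + 1) := by ring
      _ ≤ tri (n + 1) * tri N * tri (N + 1) := by gcongr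
      _ = _ := by ring

lemma sum_suffix_indicator {β : Type*} [DecidableEq β] (Z : Finset (List β)) (R : List β)
    (hZ : ∀ z, z <:+ R → z ∈ Z) (w : ℕ → ℝ) :
    ∑ z ∈ Z, (if z <:+ R then w z.length else 0) =
      ∑ e ∈ Finset.range (R.length + 1), w (R.length - e) := by
  rw [← Finset.sum_filter]
  symm
  refine Finset.sum_bij (fun e _ => R.drop e) ?_ ?_ ?_ ?_
  · intro e _
    exact Finset.mem_filter.2 ⟨hZ _ (List.drop_suffix _ _), List.drop_suffix _ _⟩
  · intro e he e' he' h
    have := congrArg List.length h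
    simp only [List.length_drop, Finset.mem_range] at *
    omega
  · intro z hz
    obtain ⟨W, rfl⟩ := (Finset.mem_filter.1 hz).2
    exact ⟨W.length, by simp, by simp⟩
  · intro e _
    simp

/-- A function `f` on `F₂` satisfies `SchurBdd C f` if, on each finite subset, the kernel
`f (t s⁻¹)` is a Gram kernel of vectors of squared length at most `C`. -/
def SchurBdd (C : ℝ) (f : G2 → ℝ) : Prop :=
  ∀ F : Finset G2, ∃ (ι : Type) (_ : Fintype ι) (p q : G2 → ι → ℝ),
    (∀ s ∈ F, ∑ i, p s i ^ 2 ≤ C) ∧ (∀ s ∈ F, ∑ i, q s i ^ 2 ≤ C) ∧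
    ∀ s ∈ F, ∀ t ∈ F, f (t * s⁻¹) = ∑ i, p s i * q t i

lemma SchurBdd.mono {C D : ℝ} {f : G2 → ℝ} (h : SchurBdd C f) (hCD : C ≤ D) :
    SchurBdd D f := by
  intro F
  obtain ⟨ι, hι, p, q, hp, hq, hf⟩ := h F
  exact ⟨ι, hι, p, q, fun s hs => (hp s hs).trans hCD, fun s hs => (hq s hs).trans hCD, hf⟩

lemma SchurBdd.add {C D : ℝ} {f g : G2 → ℝ} (hf : SchurBdd C f) (hg : SchurBdd D g) :
    SchurBdd (C + D) (fun s => f s + g s) := by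
  intro F
  obtain ⟨ι, _, p, q, hp, hq, hpq⟩ := hf F
  obtain ⟨κ, _, p', q', hp', hq', hpq'⟩ := hg F
  refine ⟨ι ⊕ κ, inferInstance, fun s => Sum.elim (p s) (p' s), fun s => Sum.elim (q s) (q' s),
    fun s hs => ?_, fun s hs => ?_, fun s hs t ht => ?_⟩
  · simpa using add_le_add (hp s hs) (hp' s hs)
  · simpa using add_le_add (hq s hs) (hq' s hs)
  · simp [hpq s hs t ht, hpq' s hs t ht]

lemma SchurBdd.smul {C c : ℝ} (hc : 0 ≤ c) {f : G2 → ℝ} (hf : SchurBdd C f) :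
    SchurBdd (c * C) (fun s => c * f s) := by
  intro F
  obtain ⟨ι, _, p, q, hp, hq, hpq⟩ := hf F
  refine ⟨ι, inferInstance, fun s i => √c * p s i, fun s i => √c * q s i,
    fun s hs => ?_, fun s hs => ?_, fun s hs t ht => ?_⟩
  · simp only [mul_pow, Real.sq_sqrt hc, ← Finset.mul_sum]
    exact mul_le_mul_of_nonneg_left (hp s hs) hc
  · simp only [mul_pow, Real.sq_sqrt hc, ← Finset.mul_sum]
    exact mul_le_mul_of_nonneg_left (hq s hs) hc
  · dsimp only
    rw [hpq s hs t ht, Finset.mul_sum]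
    refine Finset.sum_congr rfl fun i _ => ?_
    rw [mul_mul_mul_comm, Real.mul_self_sqrt hc]

lemma schurBdd_zero : SchurBdd 0 (fun _ => 0) :=
  fun _ => ⟨Empty, inferInstance, fun _ _ => 0, fun _ _ => 0, by simp, by simp, by simp⟩

lemma schurBdd_single (g : G2) : SchurBdd 1 (fun s => if g = s then 1 else 0) := by
  classical
  intro F
  refine ⟨F, inferInstance, fun s i => if (i : G2) = g * s then 1 else 0,
    fun t i => if (i : G2) = t then 1 else 0, fun s _ => ?_, fun s _ => ?_, fun s _ t ht => ?_⟩
  · rw [Finset.sum_coe_sort F (fun i => (if i = g * s then (1 : ℝ) else 0) ^ 2)]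
    simp only [ite_pow, one_pow, ne_eq, OfNat.ofNat_ne_zero, not_false_eq_true, zero_pow,
      Finset.sum_ite_eq']
    split_ifs <;> norm_num
  · rw [Finset.sum_coe_sort F (fun i => (if i = s then (1 : ℝ) else 0) ^ 2)]
    simp only [ite_pow, one_pow, ne_eq, OfNat.ofNat_ne_zero, not_false_eq_true, zero_pow,
      Finset.sum_ite_eq']
    split_ifs
    all_goals norm_num
  · rw [Finset.sum_coe_sort F
      (fun i => (if i = g * s then (1 : ℝ) else 0) * (if i = t then (1 : ℝ) else 0))]
    simp only [mul_ite, mul_one, mul_zero, Finset.sum_ite_eq', ht, if_true, eq_mul_inv_iff_mul_eq,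
      eq_comm (a := t)]

lemma sum_range_add_one_le (N L : ℕ) :
    ∑ k ∈ Finset.range N, ∑ e ∈ Finset.range (L + 1), (if L ≤ L - e + k then (1 : ℝ) else 0) ≤
      N * (N + 1) / 2 := by
  have h : ∀ k, ∑ e ∈ Finset.range (L + 1), (if L ≤ L - e + k then (1 : ℝ) else 0) ≤ k + 1 := by
    intro k
    rw [Finset.sum_boole]
    have hs : (Finset.range (L + 1)).filter (fun e => L ≤ L - e + k) ⊆ Finset.range (k + 1) := by
      intro e he
      simp only [Finset.mem_filter, Finset.mem_range] at *
      omega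
    have := Finset.card_le_card hs
    rw [Finset.card_range] at this
    exact_mod_cast this
  refine (Finset.sum_le_sum fun k _ => h k).trans (le_of_eq ?_)
  induction N with
  | zero => simp
  | succ N ih => rw [Finset.sum_range_succ, ih]; push_cast; ring

lemma sum_boole_interval (N u v e r : ℕ) (he : e ≤ r) :
    ∑ k ∈ Finset.range N,
      (if u + r ≤ r - e + k ∧ v + r ≤ r - e + (N - 1 - k) then (1 : ℝ) else 0) =
      ((N - (u + v) - 2 * e : ℕ) : ℝ) := by
  rw [Finset.sum_boole]
  have : (Finset.range N).filter
      (fun k => u + r ≤ r - e + k ∧ v + r ≤ r - e + (N - 1 - k)) =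
      Finset.Ico (u + e) (N - (v + e)) := by
    ext k
    simp only [Finset.mem_filter, Finset.mem_range, Finset.mem_Ico]
    omega
  rw [this, Nat.card_Ico]
  congr 1
  omega

lemma schurBdd_tri (N : ℕ) :
    SchurBdd (N * (N + 1) / 2) (fun s => (tri (N - wlen s) : ℝ)) := by
  classical
  intro F
  obtain ⟨m, hm⟩ : ∃ m, ∀ s ∈ F, wlen s ≤ m := ⟨F.sup wlen, fun s hs => Finset.le_sup hs⟩
  let g : G2 := of 0 ^ (m + N)
  let U : G2 → List (Fin 2 × Bool) := fun s => (s * g).toWord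
  have hU : ∀ s ∈ F, List.replicate N ((0 : Fin 2), true) <:+ U s := by
    intro s hs
    have h := replicate_suffix_reduce ((0 : Fin 2), true) (m + N) s.toWord
    rw [← toWord_of_pow (0 : Fin 2) (m + N), ← toWord_mul] at h
    refine List.IsSuffix.trans ?_ h
    have hl : s.toWord.length ≤ m := hm s hs
    refine ⟨List.replicate (m + N - s.toWord.length - N) (0, true), ?_⟩
    rw [List.replicate_append_replicate]
    congr 1
    omega
  let Z : Finset (List (Fin 2 × Bool)) := F.biUnion fun s => (U s).tails.toFinset
  have hZ : ∀ s ∈ F, ∀ z, z <:+ U s → z ∈ Z := by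
    intro s hs z hz
    exact Finset.mem_biUnion.2 ⟨s, hs, by simpa using hz⟩
  let P : G2 → ℕ → List (Fin 2 × Bool) → ℝ := fun s k z =>
    if z <:+ U s then (if (U s).length ≤ z.length + k then 1 else 0) else 0
  have hPsq : ∀ s k z, P s k z ^ 2 = P s k z := by
    intro s k z
    simp only [P]
    split_ifs <;> norm_num
  have hPsum : ∀ s ∈ F, ∑ k ∈ Finset.range N, ∑ z ∈ Z, P s k z ≤ N * (N + 1) / 2 := by
    intro s hs
    refine le_trans (le_of_eq ?_) (sum_range_add_one_le N (U s).length)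
    refine Finset.sum_congr rfl fun k _ => ?_
    exact sum_suffix_indicator Z (U s) (hZ s hs)
      (fun l => if (U s).length ≤ l + k then 1 else 0)
  refine ⟨Fin N × Z, inferInstance, fun s i => P s i.1 i.2, fun s i => P s (N - 1 - i.1) i.2,
    fun s hs => ?_, fun s hs => ?_, fun s hs t ht => ?_⟩
  · simp only [hPsq, Fintype.sum_prod_type]
    rw [Fin.sum_univ_eq_sum_range (fun k => ∑ z : Z, P s k z)]
    simp only [fun k => Finset.sum_coe_sort Z (fun z => P s k z)]
    exact hPsum s hs
  · simp only [hPsq, Fintype.sum_prod_type]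
    rw [Fin.sum_univ_eq_sum_range (fun k => ∑ z : Z, P s (N - 1 - k) z)]
    simp only [fun k => Finset.sum_coe_sort Z (fun z => P s (N - 1 - k) z)]
    rw [Finset.sum_range_reflect (fun k => ∑ z ∈ Z, P s k z)]
    exact hPsum s hs
  · obtain ⟨A, B, R, hA, hB, hR⟩ := exists_longest_common_suffix (U s) (U t)
    have hlen : wlen (t * s⁻¹) = A.length + B.length := by
      have := norm_mul_inv_of_longest (s := s * g) (t := t * g) hA hB hR
      rwa [show t * g * (s * g)⁻¹ = t * s⁻¹ by group] at this
    have hRN : N ≤ R.length := by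
      simpa using (hR _ (hU s hs) (hU t ht)).length_le
    have hPP : ∀ k z, P s k z * P t (N - 1 - k) z = if z <:+ R then
        (if A.length + R.length ≤ z.length + k ∧
          B.length + R.length ≤ z.length + (N - 1 - k) then 1 else 0) else 0 := by
      intro k z
      have h1 : z <:+ R ↔ z <:+ U s ∧ z <:+ U t :=
        ⟨fun h => ⟨h.trans ⟨A, hA.symm⟩, h.trans ⟨B, hB.symm⟩⟩, fun h => hR z h.1 h.2⟩
      have h2 : (U s).length = A.length + R.length := by rw [hA, List.length_append]
      have h3 : (U t).length = B.length + R.length := by rw [hB, List.length_append]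
      simp only [P, h1, h2, h3]
      split_ifs <;> simp_all
    simp only [Fintype.sum_prod_type]
    rw [Fin.sum_univ_eq_sum_range (fun k => ∑ z : Z, P s k z * P t (N - 1 - k) z)]
    rw [Finset.sum_congr rfl fun k _ => (Finset.sum_coe_sort Z
      (fun z => P s k z * P t (N - 1 - k) z)).trans ((Finset.sum_congr rfl fun z _ => hPP k z).trans
        (sum_suffix_indicator Z R (fun z hz => hZ s hs z (hz.trans ⟨A, hA.symm⟩))
          (fun l => if A.length + R.length ≤ l + k ∧ B.length + R.length ≤ l + (N - 1 - k)
            then (1 : ℝ) else 0)))]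
    rw [Finset.sum_comm, Finset.sum_congr rfl fun e he =>
      sum_boole_interval N A.length B.length e R.length (by simp at he; omega), ← Nat.cast_sum,
      sum_sub_two_mul _ _ (by omega), hlen]

/-- The normalised multipliers increasing to `1`. -/
noncomputable def mult (N : ℕ) (s : G2) : ℝ := tri (N - wlen s) / tri N

lemma mult_nonneg (N : ℕ) (s : G2) : 0 ≤ mult N s := by unfold mult; positivity

lemma mult_zero (s : G2) : mult 0 s = 0 := by simp [mult, tri_zero]

lemma mult_le_one (N : ℕ) (s : G2) : mult N s ≤ 1 := by
  refine div_le_one_of_le₀ ?_ (Nat.cast_nonneg _)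
  exact_mod_cast tri_mono (Nat.sub_le _ _)

lemma mult_mono (s : G2) : Monotone fun N => mult N s := by
  refine monotone_nat_of_le_succ fun N => ?_
  rcases Nat.eq_zero_or_pos N with rfl | hN
  · rw [mult_zero]; exact mult_nonneg _ _
  have h1 : (0 : ℝ) < tri N := by exact_mod_cast tri_pos hN
  have h2 : (0 : ℝ) < tri (N + 1) := by exact_mod_cast tri_pos (by omega)
  unfold mult
  rw [div_le_div_iff₀ h1 h2]
  rcases Nat.lt_or_ge N (wlen s) with h | h
  · rw [Nat.sub_eq_zero_of_le h.le, tri_zero]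
    simp only [Nat.cast_zero, zero_mul]
    positivity
  · have := tri_mul_tri_succ_le (Nat.sub_le N (wlen s))
    rw [Nat.sub_add_comm h]
    exact_mod_cast this

lemma mult_eq_zero {N : ℕ} {s : G2} (h : N ≤ wlen s) : mult N s = 0 := by
  simp [mult, Nat.sub_eq_zero_of_le h, tri_zero]

lemma schurBdd_mult (N : ℕ) : SchurBdd 2 (mult N) := by
  rcases Nat.eq_zero_or_pos N with rfl | hN
  · have : mult 0 = fun _ => 0 := funext mult_zero
    rw [this]
    exact schurBdd_zero.mono (by norm_num)
  have h1 : (0 : ℝ) < tri N := by exact_mod_cast tri_pos hN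
  have h2 : ((N * (N + 2) : ℕ) : ℝ) ≤ (4 * tri N : ℕ) := by exact_mod_cast le_four_mul_tri N
  have h := (schurBdd_tri N).smul (inv_nonneg.2 h1.le)
  have hm : mult N = fun s => (tri N : ℝ)⁻¹ * tri (N - wlen s) := by
    funext s; rw [mult, div_eq_inv_mul]
  rw [hm]
  refine h.mono ?_
  rw [inv_mul_le_iff₀ h1]
  push_cast at h2
  nlinarith [(Nat.cast_nonneg N : (0 : ℝ) ≤ N)]

lemma tendsto_mult (s : G2) : Tendsto (fun N => mult N s) atTop (𝓝 1) := by
  set d := wlen s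
  have hlow : ∀ N, d ≤ N → (1 - (d + 1 : ℝ) / (N + 1)) ^ 2 ≤ mult N s := by
    intro N hN
    rcases Nat.eq_zero_or_pos N with rfl | hpos
    · have : d = 0 := by omega
      simp [this, mult_zero]
    have h1 : (0 : ℝ) < tri N := by exact_mod_cast tri_pos hpos
    have h3 : (((N - d) * (N - d + 2) : ℕ) : ℝ) ≤ (4 * tri (N - d) : ℕ) := by
      exact_mod_cast le_four_mul_tri (N - d)
    have h4 : ((4 * tri N : ℕ) : ℝ) ≤ ((N + 1) ^ 2 : ℕ) := by exact_mod_cast four_mul_tri_le N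
    have hc : ((N - d : ℕ) : ℝ) = N - d := Nat.cast_sub hN
    push_cast [hc] at h3 h4
    have hd : (d : ℝ) ≤ N := by exact_mod_cast hN
    have e : (1 - (d + 1 : ℝ) / (N + 1)) = (N - d) / (N + 1) := by field_simp; ring
    rw [e, div_pow, mult, div_le_div_iff₀ (by positivity) h1]
    have a1 : ((N : ℝ) - d) ^ 2 ≤ 4 * tri (N - d) := by nlinarith
    nlinarith [sq_nonneg ((N : ℝ) - d)]
  refine tendsto_of_tendsto_of_tendsto_of_le_of_le' ?_ tendsto_const_nhds
    (eventually_atTop.2 ⟨d, hlow⟩) (Eventually.of_forall fun N => mult_le_one N s)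
  have h : Tendsto (fun N : ℕ => (d + 1 : ℝ) / (N + 1)) atTop (𝓝 0) :=
    Tendsto.div_atTop tendsto_const_nhds
      (tendsto_atTop_add_const_right _ _ tendsto_natCast_atTop_atTop)
  simpa using (h.const_sub 1).pow 2

lemma lam_deltaVec (g s : G2) : lam g (deltaVec s) = deltaVec (g * s) := by
  ext t
  change (deltaVec s) (g⁻¹ * t) = deltaVec (g * s) t
  simp only [deltaVec, lp.single_apply, Pi.single_apply, inv_mul_eq_iff_eq_mul]

lemma inner_deltaVec (t : G2) (ξ : H2) : inner ℂ (deltaVec t) ξ = ξ t := by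
  rw [deltaVec, lp.inner_single_left]; simp

lemma deltaFn_lam (s t : G2) : deltaFn s (lam t) = if t = s then 1 else 0 := by
  change inner ℂ (deltaVec s) (lam t (deltaVec 1)) = _
  rw [lam_deltaVec, inner_deltaVec, mul_one, deltaVec, lp.single_apply, Pi.single_apply]
  simp only [eq_comm]

lemma CrF2_induction {P : (H2 →L[ℂ] H2) → Prop} (hlam : ∀ g, P (lam g))
    (hzero : P 0) (hadd : ∀ x y, P x → P y → P (x + y)) (hsmul : ∀ (c : ℂ) x, P x → P (c • x))
    (hclosed : IsClosed {x | P x}) (x : CrF2) : P x := by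
  have h : closure ((Submodule.span ℂ (Set.range lam) : Submodule ℂ (H2 →L[ℂ] H2)) :
      Set (H2 →L[ℂ] H2)) ⊆ {x | P x} := by
    refine closure_minimal (fun y hy => ?_) hclosed
    refine Submodule.span_induction ?_ hzero (fun a b _ _ => hadd a b)
      (fun c a _ => hsmul c a) hy
    rintro _ ⟨g, rfl⟩
    exact hlam g
  exact h x.2

/-- The matrix entries of an element of `C*_r(F₂)`. -/
lemma inner_deltaVec_apply (x : CrF2) (s t : G2) :
    inner ℂ (deltaVec t) ((x : H2 →L[ℂ] H2) (deltaVec s)) = deltaCr (t * s⁻¹) x := by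
  change _ = deltaFn (t * s⁻¹) (x : H2 →L[ℂ] H2)
  refine CrF2_induction (P := fun y => inner ℂ (deltaVec t) (y (deltaVec s)) =
    deltaFn (t * s⁻¹) y) ?_ ?_ ?_ ?_ ?_ x
  · intro g
    rw [deltaFn_lam, lam_deltaVec, inner_deltaVec, deltaVec, lp.single_apply, Pi.single_apply]
    simp only [eq_mul_inv_iff_mul_eq, eq_comm]
  · simp
  · intro a b ha hb
    simp [ha, hb]
  · intro c a ha
    simp [ha]
  · refine isClosed_eq ?_ (deltaFn _).continuous
    fun_prop

/-- The finitely supported vector of `ℓ²(F₂)` with coefficients `α` on `F`. -/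
noncomputable def finVec (F : Finset G2) (α : G2 → ℂ) : H2 := ∑ s ∈ F, α s • deltaVec s

lemma inner_finVec (F : Finset G2) (α β : G2 → ℂ) (x : CrF2) :
    inner ℂ (finVec F β) ((x : H2 →L[ℂ] H2) (finVec F α)) =
      ∑ s ∈ F, ∑ t ∈ F, starRingEnd ℂ (β t) * α s * deltaCr (t * s⁻¹) x := by
  simp only [finVec, map_sum, map_smul, inner_sum, sum_inner, inner_smul_left, inner_smul_right,
    inner_deltaVec_apply]
  refine Finset.sum_congr rfl fun s _ => ?_
  rw [Finset.mul_sum]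
  exact Finset.sum_congr rfl fun t _ => by ring

lemma inner_deltaVec_deltaVec (s t : G2) :
    inner ℂ (deltaVec s) (deltaVec t) = if s = t then 1 else 0 := by
  rw [inner_deltaVec, deltaVec, lp.single_apply, Pi.single_apply]

lemma norm_finVec_sq (F : Finset G2) (α : G2 → ℂ) : ‖finVec F α‖ ^ 2 = ∑ s ∈ F, ‖α s‖ ^ 2 := by
  have h : inner ℂ (finVec F α) (finVec F α) = ((∑ s ∈ F, ‖α s‖ ^ 2 : ℝ) : ℂ) := by
    simp only [finVec, inner_sum, sum_inner, inner_smul_left, inner_smul_right,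
      inner_deltaVec_deltaVec, mul_ite, mul_one, mul_zero]
    push_cast
    refine Finset.sum_congr rfl fun s hs => ?_
    rw [Finset.sum_ite_eq', if_pos hs, ← Complex.conj_mul', mul_comm]
  rw [inner_self_eq_norm_sq_to_K] at h
  rw [← Complex.ofReal_inj, ← h]
  simp

lemma tendsto_finVec (ξ : H2) : Tendsto (fun F => finVec F ξ) atTop (𝓝 ξ) := by
  classical
  have h := lp.hasSum_single (p := 2) (by norm_num) ξ
  have e : ∀ s, lp.single 2 s (ξ s) = ξ s • deltaVec s := by
    intro s
    rw [deltaVec, ← lp.single_smul, smul_eq_mul, mul_one]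
  simp only [e] at h
  exact h

/-- The finitely supported vector of `ℓ²(F₂)ⁿ` with coefficients `α` on `F`. -/
noncomputable def piVec {n : ℕ} (F : Finset G2) (α : Fin n → G2 → ℂ) :
    PiLp 2 (fun _ : Fin n => H2) :=
  WithLp.toLp 2 fun j => finVec F (α j)

lemma norm_piVec_sq {n : ℕ} (F : Finset G2) (α : Fin n → G2 → ℂ) :
    ‖piVec F α‖ ^ 2 = ∑ j, ∑ s ∈ F, ‖α j s‖ ^ 2 := by
  simp only [PiLp.norm_sq_eq_of_L2, piVec, norm_finVec_sq]

lemma tendsto_piVec {n : ℕ} (ξ : PiLp 2 (fun _ : Fin n => H2)) :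
    Tendsto (fun F => piVec F (fun j => ξ j)) atTop (𝓝 ξ) := by
  have h : Tendsto (fun F => fun j => finVec F (ξ j)) atTop (𝓝 (WithLp.ofLp ξ)) :=
    tendsto_pi_nhds.2 fun j => tendsto_finVec (ξ j)
  exact ((PiLp.continuous_toLp 2 (fun _ : Fin n => H2)).tendsto _).comp h

lemma matOp_apply {n : ℕ} (M : Matrix (Fin n) (Fin n) (H2 →L[ℂ] H2))
    (ξ : PiLp 2 (fun _ : Fin n => H2)) (i : Fin n) : matOp M ξ i = ∑ j, M i j (ξ j) := by
  simp [matOp]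

/-- The matrix of operators underlying a matrix over `C*_r(F₂)`. -/
noncomputable def toOp {n : ℕ} (u : Matrix (Fin n) (Fin n) CrF2) :
    PiLp 2 (fun _ : Fin n => H2) →L[ℂ] PiLp 2 (fun _ : Fin n => H2) :=
  matOp (fun i j => (u i j : H2 →L[ℂ] H2))

lemma toOp_apply {n : ℕ} (u : Matrix (Fin n) (Fin n) CrF2)
    (ξ : PiLp 2 (fun _ : Fin n => H2)) (i : Fin n) :
    toOp u ξ i = ∑ j, (u i j : H2 →L[ℂ] H2) (ξ j) :=
  matOp_apply _ _ _

lemma inner_piVec {n : ℕ} (F : Finset G2) (α β : Fin n → G2 → ℂ)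
    (u : Matrix (Fin n) (Fin n) CrF2) :
    inner ℂ (piVec F β) (toOp u (piVec F α)) =
      ∑ i, ∑ j, ∑ s ∈ F, ∑ t ∈ F,
        starRingEnd ℂ (β i t) * α j s * deltaCr (t * s⁻¹) (u i j) := by
  rw [PiLp.inner_apply]
  refine Finset.sum_congr rfl fun i _ => ?_
  rw [toOp_apply, inner_sum]
  exact Finset.sum_congr rfl fun j _ => inner_finVec F (α j) (β i) (u i j)

lemma norm_le_of_forall_piVec {n : ℕ} {C : ℝ} (hC : 0 ≤ C)
    (T : PiLp 2 (fun _ : Fin n => H2) →L[ℂ] PiLp 2 (fun _ : Fin n => H2))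
    (h : ∀ (F : Finset G2) (α β : Fin n → G2 → ℂ),
      ‖inner ℂ (piVec F β) (T (piVec F α))‖ ≤ C * ‖piVec F α‖ * ‖piVec F β‖) : ‖T‖ ≤ C := by
  refine T.opNorm_le_bound hC fun ξ => ?_
  have key : ∀ η, ‖inner ℂ η (T ξ)‖ ≤ C * ‖ξ‖ * ‖η‖ := by
    intro η
    have hξ := tendsto_piVec ξ
    have hη := tendsto_piVec η
    exact le_of_tendsto_of_tendsto' ((hη.inner ((T.continuous.tendsto _).comp hξ)).norm)
      ((hξ.norm.const_mul C).mul hη.norm) fun F => h F _ _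
  have h1 := key (T ξ)
  rw [inner_self_eq_norm_sq_to_K, norm_pow, RCLike.norm_ofReal, abs_of_nonneg (norm_nonneg _),
    pow_two] at h1
  rcases (norm_nonneg (T ξ)).eq_or_lt with h0 | h0
  · rw [← h0]; positivity
  · exact le_of_mul_le_mul_right h1 h0

/-- A multiplier whose symbol satisfies `SchurBdd C` has cb-norm at most `C`. -/
lemma SchurBdd.matNorm_le {C : ℝ} (hC : 0 ≤ C) {f : G2 → ℝ} (hf : SchurBdd C f) {n : ℕ}
    (u v : Matrix (Fin n) (Fin n) CrF2)
    (huv : ∀ i j s, deltaCr s (v i j) = f s * deltaCr s (u i j)) :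
    matNorm v ≤ C * matNorm u := by
  change ‖toOp v‖ ≤ C * ‖toOp u‖
  refine norm_le_of_forall_piVec (by positivity) _ fun F α β => ?_
  obtain ⟨ι, _, p, q, hp, hq, hpq⟩ := hf F
  let A : ι → Fin n → G2 → ℂ := fun k j s => p s k * α j s
  let B : ι → Fin n → G2 → ℂ := fun k j s => q s k * β j s
  have hsum : inner ℂ (piVec F β) (toOp v (piVec F α)) =
      ∑ k, inner ℂ (piVec F (B k)) (toOp u (piVec F (A k))) := by
    simp only [inner_piVec]
    rw [Finset.sum_comm (s := (Finset.univ : Finset ι))]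
    refine Finset.sum_congr rfl fun i _ => ?_
    rw [Finset.sum_comm (s := (Finset.univ : Finset ι))]
    refine Finset.sum_congr rfl fun j _ => ?_
    rw [Finset.sum_comm (s := (Finset.univ : Finset ι))]
    refine Finset.sum_congr rfl fun s hs => ?_
    rw [Finset.sum_comm (s := (Finset.univ : Finset ι))]
    refine Finset.sum_congr rfl fun t ht => ?_
    rw [huv, hpq s hs t ht]
    push_cast
    rw [Finset.sum_mul, Finset.mul_sum]
    refine Finset.sum_congr rfl fun k _ => ?_
    have hconj : starRingEnd ℂ (B k i t) = q t k * starRingEnd ℂ (β i t) :=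
      (_root_.map_mul _ _ _).trans (by rw [Complex.conj_ofReal])
    rw [hconj]
    ring
  have hbound : ∀ (p : G2 → ι → ℝ) (γ : Fin n → G2 → ℂ), (∀ s ∈ F, ∑ k, p s k ^ 2 ≤ C) →
      ∑ k, ‖piVec F (fun j s => (p s k : ℂ) * γ j s)‖ ^ 2 ≤ C * ‖piVec F γ‖ ^ 2 := by
    intro p γ hp
    simp only [norm_piVec_sq, norm_mul, mul_pow, Complex.norm_real, Real.norm_eq_abs, sq_abs]
    rw [Finset.sum_comm, Finset.mul_sum]
    refine Finset.sum_le_sum fun j _ => ?_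
    rw [Finset.sum_comm, Finset.mul_sum]
    refine Finset.sum_le_sum fun s hs => ?_
    rw [← Finset.sum_mul]
    exact mul_le_mul_of_nonneg_right (hp s hs) (by positivity)
  have hA : ∑ k, ‖piVec F (A k)‖ ^ 2 ≤ C * ‖piVec F α‖ ^ 2 := hbound p α hp
  have hB : ∑ k, ‖piVec F (B k)‖ ^ 2 ≤ C * ‖piVec F β‖ ^ 2 := hbound q β hq
  have hCS : ∑ k, ‖piVec F (A k)‖ * ‖piVec F (B k)‖ ≤ C * ‖piVec F α‖ * ‖piVec F β‖ := by
    refine abs_le_of_sq_le_sq' ?_ (by positivity) |>.2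
    calc (∑ k, ‖piVec F (A k)‖ * ‖piVec F (B k)‖) ^ 2
        ≤ (∑ k, ‖piVec F (A k)‖ ^ 2) * ∑ k, ‖piVec F (B k)‖ ^ 2 :=
          Finset.sum_mul_sq_le_sq_mul_sq _ _ _
      _ ≤ (C * ‖piVec F α‖ ^ 2) * (C * ‖piVec F β‖ ^ 2) := by gcongr
      _ = (C * ‖piVec F α‖ * ‖piVec F β‖) ^ 2 := by ring
  rw [hsum]
  calc ‖∑ k, inner ℂ (piVec F (B k)) (toOp u (piVec F (A k)))‖
      ≤ ∑ k, ‖inner ℂ (piVec F (B k)) (toOp u (piVec F (A k)))‖ := norm_sum_le _ _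
    _ ≤ ∑ k, ‖toOp u‖ * (‖piVec F (A k)‖ * ‖piVec F (B k)‖) := by
        refine Finset.sum_le_sum fun k _ => (norm_inner_le_norm _ _).trans ?_
        calc ‖piVec F (B k)‖ * ‖toOp u (piVec F (A k))‖
            ≤ ‖piVec F (B k)‖ * (‖toOp u‖ * ‖piVec F (A k)‖) := by
              gcongr; exact (toOp u).le_opNorm _
          _ = _ := by ring
    _ = ‖toOp u‖ * ∑ k, ‖piVec F (A k)‖ * ‖piVec F (B k)‖ := by rw [Finset.mul_sum]
    _ ≤ ‖toOp u‖ * (C * ‖piVec F α‖ * ‖piVec F β‖) := by gcongr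
    _ = _ := by ring

lemma matNorm_one (u : Matrix (Fin 1) (Fin 1) CrF2) : matNorm u = ‖u 0 0‖ := by
  change ‖toOp u‖ = ‖(u 0 0 : H2 →L[ℂ] H2)‖
  have hnorm : ∀ ξ : PiLp 2 (fun _ : Fin 1 => H2), ‖ξ‖ = ‖ξ 0‖ := by
    intro ξ
    simp [PiLp.norm_eq_of_L2]
  have happ : ∀ ξ, ‖toOp u ξ‖ = ‖(u 0 0 : H2 →L[ℂ] H2) (ξ 0)‖ := by
    intro ξ
    rw [hnorm, toOp_apply, Fin.sum_univ_one]
  refine le_antisymm (ContinuousLinearMap.opNorm_le_bound _ (norm_nonneg _) fun ξ => ?_)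
    (ContinuousLinearMap.opNorm_le_bound _ (norm_nonneg _) fun ξ => ?_)
  · rw [happ, hnorm]
    exact ContinuousLinearMap.le_opNorm _ _
  · have := (toOp u).le_opNorm (WithLp.toLp 2 fun _ => ξ)
    rwa [happ, hnorm] at this

/-- The coefficients of the partial sums of a frame. -/
noncomputable def symbol (φ : ℕ → G2) (a : ℕ → ℝ) (m : ℕ) (s : G2) : ℝ :=
  ∑ n ∈ Finset.range m, if φ n = s then a n else 0

lemma deltaCr_lamCr (s t : G2) : deltaCr s (lamCr t) = if t = s then 1 else 0 := deltaFn_lam s t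

lemma deltaCr_frameOp (φ : ℕ → G2) (a : ℕ → ℝ) (m : ℕ) (x : CrF2) (s : G2) :
    deltaCr s (frameOp φ a m x) = symbol φ a m s * deltaCr s x := by
  simp only [frameOp, symbol, sum_apply, map_sum,
    ContinuousLinearMap.smulRight_apply, map_smul, deltaCr_lamCr, smul_eq_mul]
  push_cast
  rw [Finset.sum_mul]
  refine Finset.sum_congr rfl fun n _ => ?_
  split_ifs with h <;> simp [h]

lemma frameOp_lamCr (φ : ℕ → G2) (a : ℕ → ℝ) (m : ℕ) (s : G2) :
    frameOp φ a m (lamCr s) = (symbol φ a m s : ℂ) • lamCr s := by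
  simp only [frameOp, symbol, sum_apply,
    ContinuousLinearMap.smulRight_apply]
  push_cast
  rw [Finset.sum_smul]
  refine Finset.sum_congr rfl fun n _ => ?_
  by_cases h : φ n = s
  · simp [h, deltaCr_lamCr]
  · simp [h, Ne.symm h, deltaCr_lamCr]

lemma matNorm_frameOp_le {C : ℝ} (hC : 0 ≤ C) {φ : ℕ → G2} {a : ℕ → ℝ}
    (h : ∀ m, SchurBdd C (symbol φ a m)) (m n : ℕ) (u : Matrix (Fin n) (Fin n) CrF2) :
    matNorm (fun i j => frameOp φ a m (u i j)) ≤ C * matNorm u :=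
  (h m).matNorm_le hC u _ fun i j s => deltaCr_frameOp φ a m (u i j) s

lemma SchurBdd.norm_le {C : ℝ} (hC : 0 ≤ C) {f : G2 → ℝ} (hf : SchurBdd C f) {x y : CrF2}
    (hxy : ∀ s, deltaCr s y = f s * deltaCr s x) : ‖y‖ ≤ C * ‖x‖ := by
  have h := hf.matNorm_le hC (Matrix.of fun _ _ : Fin 1 => x) (Matrix.of fun _ _ => y)
    fun _ _ s => hxy s
  rw [matNorm_one, matNorm_one] at h
  exact h

lemma tendsto_frameOp {C : ℝ} (hC : 0 ≤ C) {φ : ℕ → G2} {a : ℕ → ℝ}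
    (h : ∀ m, SchurBdd C (symbol φ a m))
    (hlim : ∀ s, Tendsto (fun m => symbol φ a m s) atTop (𝓝 1)) (x : CrF2) :
    Tendsto (fun m => frameOp φ a m x) atTop (𝓝 x) := by
  have hbd : ∀ m (y : CrF2), ‖frameOp φ a m y‖ ≤ C * ‖y‖ := fun m y =>
    (h m).norm_le hC (deltaCr_frameOp φ a m y)
  have hspan : ∀ y ∈ Submodule.span ℂ (Set.range lamCr),
      Tendsto (fun m => frameOp φ a m y) atTop (𝓝 y) := by
    intro y hy
    induction hy using Submodule.span_induction with
    | mem y hy =>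
      obtain ⟨s, rfl⟩ := hy
      simp only [frameOp_lamCr]
      have h1 : Tendsto (fun m => ((symbol φ a m s : ℝ) : ℂ)) atTop (𝓝 ((1 : ℝ) : ℂ)) :=
        (Complex.continuous_ofReal.tendsto _).comp (hlim s)
      simpa using h1.smul_const (lamCr s)
    | zero => simp
    | add y z _ _ hy hz => simpa using hy.add hz
    | smul c y _ hy => simpa using hy.const_smul c
  have hdense : x ∈ closure ((Submodule.span ℂ (Set.range lamCr) : Submodule ℂ CrF2) :
      Set CrF2) := by
    rw [closure_subtype, ← Submodule.coe_subtype, ← Submodule.map_coe, Submodule.map_span,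
      ← Set.range_comp]
    exact x.2
  rw [Metric.tendsto_atTop]
  intro ε hε
  obtain ⟨y, hy, hxy⟩ := Metric.mem_closure_iff.1 hdense (ε / (C + 2)) (by positivity)
  obtain ⟨M, hM⟩ := Metric.tendsto_atTop.1 (hspan y hy) (ε / (C + 2)) (by positivity)
  refine ⟨M, fun m hm => ?_⟩
  have h1 : dist (frameOp φ a m x) (frameOp φ a m y) ≤ C * dist x y := by
    rw [dist_eq_norm, dist_eq_norm, ← map_sub]
    exact hbd m _
  have h2 := hM m hm
  calc dist (frameOp φ a m x) x
      ≤ dist (frameOp φ a m x) (frameOp φ a m y) + dist (frameOp φ a m y) y + dist y x :=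
        dist_triangle4 _ _ _ _
    _ < C * (ε / (C + 2)) + ε / (C + 2) + ε / (C + 2) := by
        rw [dist_comm y x]
        have : C * dist x y ≤ C * (ε / (C + 2)) := by gcongr
        linarith
    _ = ε := by field_simp; ring

/-- The symbol of a finite list of weighted group elements. -/
noncomputable def listSymbol (l : List (G2 × ℝ)) (s : G2) : ℝ :=
  (l.map fun p => if p.1 = s then p.2 else 0).sum

lemma listSymbol_append (l l' : List (G2 × ℝ)) (s : G2) :
    listSymbol (l ++ l') s = listSymbol l s + listSymbol l' s := by
  simp [listSymbol]

lemma listSymbol_flatten_replicate (n : ℕ) (l : List (G2 × ℝ)) (s : G2) :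
    listSymbol (List.replicate n l).flatten s = n * listSymbol l s := by
  induction n with
  | zero => simp [listSymbol]
  | succ n ih =>
    rw [List.replicate_succ, List.flatten_cons, listSymbol_append, ih]
    push_cast
    ring

lemma schurBdd_listSymbol (l : List (G2 × ℝ)) (hl : ∀ p ∈ l, 0 < p.2) :
    SchurBdd (l.map Prod.snd).sum (listSymbol l) := by
  induction l with
  | nil => exact schurBdd_zero
  | cons p l ih =>
    have h1 := ((schurBdd_single p.1).smul (hl p (by simp)).le).add
      (ih fun q hq => hl q (by simp [hq]))
    convert h1 using 1
    · simp
    · funext s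
      simp [listSymbol]

lemma exists_listSymbol_take (k n : ℕ) (l : List (G2 × ℝ)) :
    ∃ i ≤ n, ∃ k', ∀ s, listSymbol ((List.replicate n l).flatten.take k) s =
      i * listSymbol l s + listSymbol (l.take k') s := by
  induction n generalizing k with
  | zero => exact ⟨0, le_rfl, 0, by simp [listSymbol]⟩
  | succ n ih =>
    rw [List.replicate_succ, List.flatten_cons, List.take_append]
    rcases Nat.le_total k l.length with h | h
    · exact ⟨0, Nat.zero_le _, k, by simp [Nat.sub_eq_zero_of_le h]⟩
    · obtain ⟨i, hi, k', hk⟩ := ih (k - l.length)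
      refine ⟨i + 1, by omega, k', fun s => ?_⟩
      rw [List.take_of_length_le h, listSymbol_append, hk]
      push_cast
      ring

/-- The increment of the multipliers `mult`. -/
noncomputable def incr (N : ℕ) (s : G2) : ℝ := mult (N + 1) s - mult N s

lemma incr_nonneg (N : ℕ) (s : G2) : 0 ≤ incr N s := sub_nonneg.2 (mult_mono s (Nat.le_succ N))

lemma incr_le_one (N : ℕ) (s : G2) : incr N s ≤ 1 := by
  unfold incr
  linarith [mult_le_one (N + 1) s, mult_nonneg N s]

lemma finite_support_incr (N : ℕ) : {s : G2 | 0 < incr N s}.Finite := by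
  refine Set.Finite.subset ((List.finite_length_le (Fin 2 × Bool) N).preimage
    FreeGroup.toWord_injective.injOn) fun s hs => ?_
  by_contra h
  have h' : N + 1 ≤ wlen s := by simpa [wlen] using h
  have hs' : 0 < incr N s := hs
  rw [incr, mult_eq_zero h', mult_eq_zero (by omega)] at hs'
  simp at hs'

/-- The support of `incr N`. -/
noncomputable def supp (N : ℕ) : Finset G2 := (finite_support_incr N).toFinset

lemma mem_supp {N : ℕ} {s : G2} : s ∈ supp N ↔ 0 < incr N s := by simp [supp]

lemma card_supp_pos (N : ℕ) : 0 < (supp N).card := by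
  refine Finset.card_pos.2 ⟨FreeGroup.of 0 ^ N, mem_supp.2 ?_⟩
  have hw : wlen (FreeGroup.of 0 ^ N) = N := by simp [wlen, FreeGroup.toWord_of_pow]
  rw [incr, mult_eq_zero hw.ge, sub_zero, mult, hw]
  have h1 : 0 < tri (N + 1 - N) := tri_pos (by omega)
  have h2 : 0 < tri (N + 1) := tri_pos (by omega)
  positivity

/-- A single pass through the support of `incr N`, with small weights. -/
noncomputable def sweep (N : ℕ) : List (G2 × ℝ) :=
  (supp N).toList.map fun s => (s, incr N s / (supp N).card)

lemma sweep_pos {N : ℕ} {p : G2 × ℝ} (hp : p ∈ sweep N) : 0 < p.2 := by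
  obtain ⟨s, hs, rfl⟩ := List.mem_map.1 hp
  exact div_pos (mem_supp.1 (Finset.mem_toList.1 hs)) (by exact_mod_cast card_supp_pos N)

lemma listSymbol_sweep (N : ℕ) (s : G2) : listSymbol (sweep N) s = incr N s / (supp N).card := by
  rw [listSymbol, sweep, List.map_map]
  simp only [Function.comp_def]
  rw [Finset.sum_map_toList, Finset.sum_ite_eq']
  split_ifs with h
  · rfl
  · rw [le_antisymm (not_lt.1 (mt mem_supp.2 h)) (incr_nonneg N s), zero_div]

lemma sum_sweep_le_one (N : ℕ) : ((sweep N).map Prod.snd).sum ≤ 1 := by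
  rw [sweep, List.map_map]
  simp only [Function.comp_def]
  have h0 : (0 : ℝ) < (supp N).card := by exact_mod_cast card_supp_pos N
  rw [Finset.sum_map_toList, ← Finset.sum_div, div_le_one h0]
  simpa using Finset.sum_le_sum (s := supp N) fun s _ => incr_le_one N s

lemma schurBdd_take_sweep (N k : ℕ) : SchurBdd 1 (listSymbol ((sweep N).take k)) := by
  refine (schurBdd_listSymbol _ fun p hp => sweep_pos (List.mem_of_mem_take hp)).mono
    (le_trans ?_ (sum_sweep_le_one N))
  conv_rhs => rw [← List.take_append_drop k (sweep N), List.map_append, List.sum_append]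
  refine le_add_of_nonneg_right (List.sum_nonneg fun x hx => ?_)
  obtain ⟨p, hp, rfl⟩ := List.mem_map.1 hx
  exact (sweep_pos (List.mem_of_mem_drop hp)).le

/-- The initial segments of the frame. -/
noncomputable def frameList : ℕ → List (G2 × ℝ)
  | 0 => []
  | N + 1 => frameList N ++ (List.replicate (supp N).card (sweep N)).flatten

lemma frameList_pos {N : ℕ} {p : G2 × ℝ} (hp : p ∈ frameList N) : 0 < p.2 := by
  induction N with
  | zero => simp [frameList] at hp
  | succ N ih =>
    rcases List.mem_append.1 hp with h | h
    · exact ih h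
    · obtain ⟨l, hl, hpl⟩ := List.mem_flatten.1 h
      exact sweep_pos (List.eq_of_mem_replicate hl ▸ hpl)

lemma le_length_frameList (N : ℕ) : N ≤ (frameList N).length := by
  induction N with
  | zero => exact Nat.zero_le _
  | succ N ih =>
    have h := card_supp_pos N
    have : 0 < (supp N).card * (supp N).card := Nat.mul_pos h h
    simp only [frameList, List.length_append, List.length_flatten, List.map_replicate,
      List.sum_replicate, sweep, List.length_map, Finset.length_toList, smul_eq_mul]
    omega

lemma frameList_prefix {M N : ℕ} (h : M ≤ N) : frameList M <+: frameList N := by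
  induction N, h using Nat.le_induction with
  | base => exact List.prefix_rfl
  | succ N _ ih => exact ih.trans (List.prefix_append _ _)

lemma listSymbol_frameList (N : ℕ) (s : G2) : listSymbol (frameList N) s = mult N s := by
  induction N with
  | zero => simp [frameList, listSymbol, mult_zero]
  | succ N ih =>
    have h0 : ((supp N).card : ℝ) ≠ 0 := by exact_mod_cast (card_supp_pos N).ne'
    rw [frameList, listSymbol_append, listSymbol_flatten_replicate, listSymbol_sweep, ih,
      mul_div_cancel₀ _ h0, incr]
    ring

lemma schurBdd_take_frameList (N k : ℕ) : SchurBdd 3 (listSymbol ((frameList N).take k)) := by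
  induction N generalizing k with
  | zero =>
    rw [frameList, List.take_nil]
    exact schurBdd_zero.mono (by norm_num)
  | succ N ih =>
    rw [frameList, List.take_append]
    rcases Nat.le_total k (frameList N).length with h | h
    · simpa [Nat.sub_eq_zero_of_le h] using ih k
    · rw [List.take_of_length_le h]
      obtain ⟨i, hi, k', hk⟩ := exists_listSymbol_take (k - (frameList N).length)
        (supp N).card (sweep N)
      have h0 : (0 : ℝ) < (supp N).card := by exact_mod_cast card_supp_pos N
      set θ : ℝ := i / (supp N).card with hθ
      have hθ0 : 0 ≤ θ := by positivity
      have hθ1 : θ ≤ 1 := div_le_one_of_le₀ (by exact_mod_cast hi) h0.le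
      have key := (((schurBdd_mult N).smul (sub_nonneg.2 hθ1)).add
        ((schurBdd_mult (N + 1)).smul hθ0)).add (schurBdd_take_sweep N k')
      convert key.mono (by linarith : (1 - θ) * 2 + θ * 2 + 1 ≤ (3 : ℝ)) using 1
      funext s
      rw [listSymbol_append, hk, listSymbol_frameList, listSymbol_sweep, incr, hθ]
      field_simp
      ring

/-- The `n`-th weighted group element of the frame. -/
noncomputable def frameEntry (n : ℕ) : G2 × ℝ :=
  (frameList (n + 1))[n]'(le_length_frameList (n + 1))

lemma getElem_frameList {n M : ℕ} (h : n < (frameList M).length) :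
    (frameList M)[n] = frameEntry n := by
  rcases Nat.le_total M (n + 1) with hM | hM
  · exact (frameList_prefix hM).getElem h
  · exact ((frameList_prefix hM).getElem (le_length_frameList (n + 1))).symm

/-- The group elements of the frame. -/
noncomputable def frameElt (n : ℕ) : G2 := (frameEntry n).1

/-- The weights of the frame. -/
noncomputable def frameWeight (n : ℕ) : ℝ := (frameEntry n).2

lemma frameWeight_pos (n : ℕ) : 0 < frameWeight n := frameList_pos (List.getElem_mem _)

lemma symbol_frame {m M : ℕ} (h : m ≤ (frameList M).length) (s : G2) :
    symbol frameElt frameWeight m s = listSymbol ((frameList M).take m) s := by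
  induction m with
  | zero => simp [symbol, listSymbol]
  | succ m ih =>
    rw [symbol, Finset.sum_range_succ, ← symbol, ih (by omega),
      ← List.take_concat_get' (frameList M) m h, listSymbol_append, getElem_frameList h]
    simp only [listSymbol, List.map_cons, List.map_nil, List.sum_singleton]
    rfl

lemma schurBdd_symbol_frame (m : ℕ) : SchurBdd 3 (symbol frameElt frameWeight m) := by
  rw [funext (symbol_frame (le_length_frameList m))]
  exact schurBdd_take_frameList m m

lemma symbol_mono (s : G2) : Monotone fun m => symbol frameElt frameWeight m s := by
  refine monotone_nat_of_le_succ fun m => ?_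
  rw [symbol, symbol, Finset.sum_range_succ]
  refine le_add_of_nonneg_right ?_
  split_ifs
  · exact (frameWeight_pos m).le
  · exact le_rfl

lemma symbol_length_frameList (N : ℕ) (s : G2) :
    symbol frameElt frameWeight (frameList N).length s = mult N s := by
  rw [symbol_frame le_rfl, List.take_length, listSymbol_frameList]

lemma tendsto_symbol_frame (s : G2) :
    Tendsto (fun m => symbol frameElt frameWeight m s) atTop (𝓝 1) := by
  have hlen : Tendsto (fun N => (frameList N).length) atTop atTop :=
    tendsto_atTop_mono le_length_frameList tendsto_id
  refine (tendsto_iff_tendsto_subseq_of_monotone (symbol_mono s) hlen).2 ?_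
  simpa only [Function.comp_def, symbol_length_frameList] using tendsto_mult s

lemma tsum_frameWeight (s : G2) :
    ∑' n : (frameElt ⁻¹' {s} : Set ℕ), frameWeight (n : ℕ) = 1 := by
  rw [tsum_subtype]
  refine HasSum.tsum_eq ((hasSum_iff_tendsto_nat_of_nonneg (fun n => ?_) 1).2 ?_)
  · exact Set.indicator_nonneg (fun n _ => (frameWeight_pos n).le) n
  · refine (tendsto_symbol_frame s).congr fun m => Finset.sum_congr rfl fun n _ => ?_
    by_cases h : frameElt n = s <;> simp [h]

lemma frameElt_surjective : Function.Surjective frameElt := by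
  intro s
  by_contra h
  have : IsEmpty (frameElt ⁻¹' {s} : Set ℕ) := ⟨fun n => h ⟨n, n.2⟩⟩
  have h1 := tsum_frameWeight s
  rw [tsum_empty] at h1
  exact zero_ne_one h1

end CbFrame

/-- **cb-frame for `C*_r(F₂)`**: there exist a surjective `φ : ℕ → F₂` and positive scalars
`(a_n)` such that (i) `∑_{n ∈ φ⁻¹(s)} a_n = 1` for every `s ∈ F₂`; (ii) for every
`x ∈ C*_r(F₂)` the series `∑ₙ a_n δ_{φ(n)}(x) λ_{φ(n)}` converges in operator norm to `x`;
(iii) the partial-sum operators `S_m` are completely bounded, uniformly in `m`.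
Thus `(λ_{φ(n)}, a_n δ_{φ(n)})` is a cb-frame for `C*_r(F₂)`. -/
theorem exists_cbFrame_CrF2 :
    ∃ (φ : ℕ → G2) (a : ℕ → ℝ),
      Function.Surjective φ ∧
      (∀ n, 0 < a n) ∧
      (∀ s : G2, ∑' n : (φ ⁻¹' {s} : Set ℕ), a (n : ℕ) = 1) ∧
      (∀ x : CrF2,
        Filter.Tendsto (fun m => frameOp φ a m x) Filter.atTop (nhds x)) ∧
      (∃ C : ℝ, ∀ (m n : ℕ) (u : Matrix (Fin n) (Fin n) CrF2),
        matNorm (fun i j => frameOp φ a m (u i j)) ≤ C * matNorm u) := by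
  exact ⟨CbFrame.frameElt, CbFrame.frameWeight, CbFrame.frameElt_surjective,
    CbFrame.frameWeight_pos, CbFrame.tsum_frameWeight,
    CbFrame.tendsto_frameOp (by norm_num) CbFrame.schurBdd_symbol_frame
      CbFrame.tendsto_symbol_frame,
    3, CbFrame.matNorm_frameOp_le (by norm_num) CbFrame.schurBdd_symbol_frame⟩
end

section
/- A separable Banach space X has the bounded approximation property if and only if X has a frame, i.e., there exists a sequence (x_n, f_n) in X × X* such that x = ∑_{n=1}^∞ f_n(x) x_n in norm for every x ∈ X. -/
open Filter

/-- Nonempty finite lists can be concatenated into one infinite sequence, each initial segment of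
which consists of the first few lists followed by an initial segment of the next one. -/
theorem exists_seq_concat_lists {α : Type*} (B : ℕ → List α) (hB : ∀ k, B k ≠ []) :
    ∃ (a : ℕ → α) (κ μ : ℕ → ℕ), Tendsto κ atTop atTop ∧
      ∀ N, (List.range N).map a =
        ((List.range (κ N)).map B).flatten ++ (B (κ N)).take (μ N) := by
  have hpos : ∀ k, 0 < (B k).length := fun k => List.length_pos_iff.2 (hB k)
  let State := {p : ℕ × ℕ // p.2 < (B p.1).length}
  let next : State → State := fun p =>
    if h : p.1.2 + 1 < (B p.1.1).length then ⟨(p.1.1, p.1.2 + 1), h⟩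
    else ⟨(p.1.1 + 1, 0), hpos _⟩
  let s : ℕ → State := fun n => Nat.rec ⟨(0, 0), hpos 0⟩ (fun _ p => next p) n
  have key : ∀ N, (List.range N).map (fun n => (B (s n).1.1)[(s n).1.2]'(s n).2) =
      ((List.range (s N).1.1).map B).flatten ++ (B (s N).1.1).take (s N).1.2 := by
    intro N
    induction N with
    | zero => simp [s]
    | succ N ih =>
      have hs : s (N + 1) = next (s N) := rfl
      rw [List.range_succ, List.map_append, ih, hs]
      have h2 := (s N).2
      by_cases h : (s N).1.2 + 1 < (B (s N).1.1).length
      · simp only [next, dif_pos h]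
        rw [List.take_add_one]
        simp [h2]
      · have h3 : (B (s N).1.1).length = (s N).1.2 + 1 := by omega
        have h4 : (B (s N).1.1).take (s N).1.2 ++ [(B (s N).1.1)[(s N).1.2]'h2] =
            B (s N).1.1 := by
          rw [List.take_append_getElem, ← h3, List.take_length]
        simp only [next, dif_neg h, List.range_succ, List.map_append, List.flatten_append,
          List.take_zero, List.append_nil, List.map_cons, List.map_nil, List.flatten_cons,
          List.flatten_nil, List.append_assoc, h4]
  refine ⟨_, fun N => (s N).1.1, fun N => (s N).1.2, ?_, key⟩
  have hmono : Monotone fun K => (((List.range K).map B).flatten).length :=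
    monotone_nat_of_le_succ fun K => by simp [List.range_succ]
  refine tendsto_atTop.2 fun K => ?_
  filter_upwards [eventually_gt_atTop (((List.range K).map B).flatten).length] with N hN
  by_contra! hlt
  have h1 := congrArg List.length (key N)
  have h2 := hmono (Nat.succ_le_of_lt hlt)
  have h3 := (s N).2
  simp only [List.range_succ, List.map_append, List.flatten_append, List.length_append,
    List.map_cons, List.map_nil, List.flatten_cons, List.flatten_nil, List.append_nil,
    Nat.succ_eq_add_one] at h2
  rw [List.length_append, List.length_map, List.length_range, List.length_take] at h1
  omega

/-- If all initial sums of a list are small, then each initial sum of its `M`-fold repetition is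
close to an integer multiple of its total sum. -/
theorem exists_norm_sum_take_flatten_replicate_sub_le {E : Type*} [SeminormedAddCommGroup E]
    (L : List E) {ε : ℝ} (hε : ∀ m, ‖(L.take m).sum‖ ≤ ε) (M m : ℕ) :
    ∃ j ≤ M, ‖((List.replicate M L).flatten.take m).sum - j • L.sum‖ ≤ ε := by
  induction M generalizing m with
  | zero => exact ⟨0, le_rfl, by simpa using hε 0⟩
  | succ M ih =>
    rw [List.replicate_succ, List.flatten_cons, List.take_append]
    rcases le_total m L.length with h | h
    · exact ⟨0, Nat.zero_le _, by simpa [Nat.sub_eq_zero_of_le h] using hε m⟩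
    · obtain ⟨j, hj, hle⟩ := ih (m - L.length)
      refine ⟨j + 1, by omega, ?_⟩
      rw [List.take_of_length_le h, List.sum_append, succ_nsmul']
      simpa using hle

theorem List.norm_sum_take_le {E : Type*} [SeminormedAddCommGroup E] (L : List E) (m : ℕ) :
    ‖(L.take m).sum‖ ≤ (L.map norm).sum := by
  induction L generalizing m with
  | nil => simp
  | cons a L ih =>
    cases m with
    | zero =>
      have := (norm_nonneg _).trans (ih 0)
      simp only [List.take_zero, List.sum_nil, norm_zero, List.map_cons, List.sum_cons]
      positivity
    | succ m =>
      simp only [List.take_succ_cons, List.map_cons, List.sum_cons]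
      exact (norm_add_le _ _).trans (by gcongr; exact ih m)

section FiniteRank

variable {X : Type*} [NormedAddCommGroup X] [NormedSpace ℂ X]

/-- A finite-rank operator is a finite sum of rank-one operators. -/
theorem exists_list_sum_smulRight_eq (T : X →L[ℂ] X)
    [FiniteDimensional ℂ (LinearMap.range (T : X →ₗ[ℂ] X))] :
    ∃ L : List (X × (X →L[ℂ] ℂ)), (L.map fun p => p.2.smulRight p.1).sum = T := by
  let b := Module.finBasis ℂ (LinearMap.range (T : X →ₗ[ℂ] X))
  let T' : X →L[ℂ] LinearMap.range (T : X →ₗ[ℂ] X) :=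
    T.codRestrict _ fun v => ⟨v, rfl⟩
  let g := fun i => (LinearMap.toContinuousLinearMap (b.coord i)).comp T'
  refine ⟨List.ofFn fun i => ((b i : X), g i), ?_⟩
  rw [List.map_ofFn, List.sum_ofFn]
  ext v
  have h := congrArg Subtype.val (b.sum_repr (T' v))
  simp only [Submodule.coe_sum, Submodule.coe_smul] at h
  simp only [sum_apply, Function.comp_apply, ContinuousLinearMap.smulRight_apply]
  exact h

/-- A finite-rank operator is a finite sum of rank-one operators, all of whose initial sums are
close to the segment from `0` to the operator. -/
theorem exists_list_sum_smulRight_eq_of_pos (T : X →L[ℂ] X)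
    [FiniteDimensional ℂ (LinearMap.range (T : X →ₗ[ℂ] X))] {ε : ℝ} (hε : 0 < ε) :
    ∃ L : List (X × (X →L[ℂ] ℂ)), L ≠ [] ∧ (L.map fun p => p.2.smulRight p.1).sum = T ∧
      ∀ m, ∃ t : ℝ, 0 ≤ t ∧ t ≤ 1 ∧
        ‖((L.take m).map fun p => p.2.smulRight p.1).sum - (t : ℂ) • T‖ ≤ ε := by
  obtain ⟨L, hL⟩ := exists_list_sum_smulRight_eq T
  set op : X × (X →L[ℂ] ℂ) → (X →L[ℂ] X) := fun p => p.2.smulRight p.1 with hop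
  set S := ((L.map op).map norm).sum with hS
  obtain ⟨n, hn⟩ := exists_nat_gt (S / ε)
  set M := n + 1 with hM
  have hM0 : (0 : ℝ) < M := by positivity
  have hMC : (M : ℂ) ≠ 0 := by exact_mod_cast hM0.ne'
  set c : ℂ := (M : ℂ)⁻¹ with hc
  set Q : List (X × (X →L[ℂ] ℂ)) := L.map fun p => (p.1, c • p.2) with hQ
  have hQop : Q.map op = (L.map op).map (c • ·) := by
    rw [hQ, List.map_map, List.map_map]
    refine List.map_congr_left fun p _ => ?_
    ext v
    simp [hop, mul_smul]
  have hsum : (Q.map op).sum = c • T := by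
    rw [hQop, ← hL, List.smul_sum]
  have hsmall : ∀ m, ‖((Q.map op).take m).sum‖ ≤ ε := by
    intro m
    rw [hQop, ← List.map_take, ← List.smul_sum, norm_smul, hc, norm_inv, Complex.norm_natCast,
      inv_mul_le_iff₀ hM0]
    refine (List.norm_sum_take_le _ m).trans ?_
    rw [div_lt_iff₀ hε] at hn
    rw [hM]
    push_cast
    nlinarith
  have htake := exists_norm_sum_take_flatten_replicate_sub_le (Q.map op) hsmall M
  have hflat : (List.replicate M Q).flatten.map op = (List.replicate M (Q.map op)).flatten := by
    rw [List.map_flatten, List.map_replicate]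
  refine ⟨(0, 0) :: (List.replicate M Q).flatten, List.cons_ne_nil _ _, ?_, fun m => ?_⟩
  · have h0 : op (0, 0) = 0 := by ext; simp [hop]
    rw [List.map_cons, List.sum_cons, h0, zero_add, hflat, List.sum_flatten, List.map_replicate,
      List.sum_replicate, hsum, ← Nat.cast_smul_eq_nsmul ℂ, smul_smul, hc, mul_inv_cancel₀ hMC,
      one_smul]
  · have h0 : op (0, 0) = 0 := by ext; simp [hop]
    cases m with
    | zero => exact ⟨0, le_rfl, zero_le_one, by simpa using hε.le⟩
    | succ m =>
      obtain ⟨j, hj, hle⟩ := htake m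
      refine ⟨j / M, by positivity, div_le_one_of_le₀ (by exact_mod_cast hj) hM0.le, ?_⟩
      rw [List.take_succ_cons, List.map_cons, List.sum_cons, h0, zero_add, List.map_take, hflat]
      rw [hsum, ← Nat.cast_smul_eq_nsmul ℂ, smul_smul, hc] at hle
      simpa [div_eq_mul_inv] using hle

/-- A space on which finite-rank operators converge pointwise to the identity has a frame. -/
theorem exists_frame_of_tendsto_finiteRank (Φ : ℕ → X →L[ℂ] X)
    (hfin : ∀ k, FiniteDimensional ℂ (LinearMap.range (Φ k : X →ₗ[ℂ] X)))
    (hΦ : ∀ x : X, Tendsto (fun k => Φ k x) atTop (nhds x)) :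
    ∃ (x : ℕ → X) (f : ℕ → (X →L[ℂ] ℂ)),
      ∀ v : X,
        Tendsto (fun N => ∑ n ∈ Finset.range N, f n v • x n) atTop (nhds v) := by
  obtain ⟨Ψ, hΨ0, hΨs⟩ : ∃ Ψ : ℕ → X →L[ℂ] X, Ψ 0 = 0 ∧ ∀ k, Ψ (k + 1) = Φ k :=
    ⟨fun k => Nat.casesOn k 0 Φ, rfl, fun _ => rfl⟩
  have hΨfin : ∀ k, FiniteDimensional ℂ (LinearMap.range (Ψ k : X →ₗ[ℂ] X)) := by
    rintro (_ | k)
    · rw [hΨ0, ContinuousLinearMap.toLinearMap_zero, LinearMap.range_zero]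
      infer_instance
    · exact hΨs k ▸ hfin k
  have hΨ : ∀ x, Tendsto (fun k => Ψ k x) atTop (nhds x) := fun x =>
    (tendsto_add_atTop_iff_nat 1).1 (by simpa only [hΨs] using hΦ x)
  have hTfin : ∀ k,
      FiniteDimensional ℂ (LinearMap.range (↑(Ψ (k + 1) - Ψ k) : X →ₗ[ℂ] X)) := by
    intro k
    have := hΨfin k
    have := hΨfin (k + 1)
    refine Submodule.finiteDimensional_of_le (S₂ := LinearMap.range (Ψ (k + 1) : X →ₗ[ℂ] X) ⊔
      LinearMap.range (Ψ k : X →ₗ[ℂ] X)) ?_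
    rintro _ ⟨v, rfl⟩
    exact Submodule.sub_mem _ (Submodule.mem_sup_left ⟨v, rfl⟩)
      (Submodule.mem_sup_right ⟨v, rfl⟩)
  choose B hBne hBsum hBtake using fun k : ℕ =>
    have := hTfin k
    exists_list_sum_smulRight_eq_of_pos (Ψ (k + 1) - Ψ k) (Nat.one_div_pos_of_nat (n := k))
  obtain ⟨a, κ, μ, hκ, ha⟩ := exists_seq_concat_lists B hBne
  have hpre : ∀ K, ((((List.range K).map B).flatten).map fun p => p.2.smulRight p.1).sum =
      Ψ K := by
    intro K
    induction K with
    | zero => exact hΨ0.symm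
    | succ K ih =>
      rw [List.range_succ, List.map_append, List.flatten_append, List.map_append, List.sum_append,
        ih]
      simp [hBsum]
  refine ⟨fun n => (a n).1, fun n => (a n).2, fun v => ?_⟩
  have hbound : ∀ N, ‖(∑ n ∈ Finset.range N, (a n).2 v • (a n).1) - v‖ ≤
      ‖Ψ (κ N) v - v‖ + ‖Ψ (κ N + 1) v - v‖ + 1 / ((κ N : ℝ) + 1) * ‖v‖ := by
    intro N
    obtain ⟨t, ht0, ht1, hle⟩ := hBtake (κ N) (μ N)
    set R := (((B (κ N)).take (μ N)).map fun p => p.2.smulRight p.1).sum with hR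
    have hsum : ∑ n ∈ Finset.range N, (a n).2 v • (a n).1 = Ψ (κ N) v + R v := by
      have h := congrArg (fun l : List (X × (X →L[ℂ] ℂ)) =>
        (l.map fun p => p.2.smulRight p.1).sum) (ha N)
      simp only [List.map_append, List.sum_append, hpre, List.map_map] at h
      rw [← hR] at h
      rw [← add_apply, ← h, ← List.sum_toFinset _ List.nodup_range, List.toFinset_range]
      simp
    have hRv := ContinuousLinearMap.le_of_opNorm_le _ hle v
    have hdecomp : Ψ (κ N) v + R v - v =
        ((1 - t : ℝ) : ℂ) • (Ψ (κ N) v - v) + (t : ℂ) • (Ψ (κ N + 1) v - v) +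
          (R - (t : ℂ) • (Ψ (κ N + 1) - Ψ (κ N))) v := by
      simp only [sub_apply, smul_apply]
      push_cast
      module
    rw [hsum, hdecomp]
    refine norm_add₃_le.trans (add_le_add (add_le_add ?_ ?_) hRv)
    · rw [norm_smul, Complex.norm_of_nonneg (by linarith)]
      exact mul_le_of_le_one_left (norm_nonneg _) (by linarith)
    · rw [norm_smul, Complex.norm_of_nonneg ht0]
      exact mul_le_of_le_one_left (norm_nonneg _) ht1
  rw [tendsto_iff_norm_sub_tendsto_zero]
  have h1 := tendsto_iff_norm_sub_tendsto_zero.1 (hΨ v)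
  have h2 := (tendsto_add_atTop_iff_nat 1).2 h1
  have h3 := (tendsto_one_div_add_atTop_nhds_zero_nat (𝕜 := ℝ)).mul_const ‖v‖
  have hlim := ((h1.add h2).add h3).comp hκ
  simp only [zero_mul, add_zero] at hlim
  exact squeeze_zero (fun _ => norm_nonneg _) hbound hlim

/-- The partial sum operators of a frame witness the bounded approximation property. -/
theorem exists_bounded_finiteRank_of_frame [CompleteSpace X] (x : ℕ → X) (f : ℕ → (X →L[ℂ] ℂ))
    (hf : ∀ v : X,
      Tendsto (fun N => ∑ n ∈ Finset.range N, f n v • x n) atTop (nhds v)) :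
    ∃ Φ : ℕ → X →L[ℂ] X,
      (∀ k, FiniteDimensional ℂ (LinearMap.range (Φ k : X →ₗ[ℂ] X))) ∧
      (∃ C : ℝ, ∀ k, ‖Φ k‖ ≤ C) ∧
      (∀ x : X, Tendsto (fun k => Φ k x) atTop (nhds x)) := by
  let Φ : ℕ → X →L[ℂ] X := fun N => ∑ n ∈ Finset.range N, (f n).smulRight (x n)
  have hΦ : ∀ N v, Φ N v = ∑ n ∈ Finset.range N, f n v • x n := fun N v => by
    simp [Φ]
  have hlim : ∀ v, Tendsto (fun k => Φ k v) atTop (nhds v) := fun v => by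
    simpa only [hΦ] using hf v
  refine ⟨Φ, fun k => ?_, banach_steinhaus fun v => ?_, hlim⟩
  · classical
    refine Submodule.finiteDimensional_of_le (S₂ := Submodule.span ℂ
      (((Finset.range k).image x : Finset X) : Set X)) ?_
    rintro _ ⟨v, rfl⟩
    rw [ContinuousLinearMap.coe_coe, hΦ]
    exact Submodule.sum_mem _ fun n hn => Submodule.smul_mem _ _
      (Submodule.subset_span (Finset.mem_coe.2 (Finset.mem_image_of_mem x hn)))
  · obtain ⟨C, hC⟩ := (hlim v).norm.bddAbove_range
    exact ⟨C, fun k => hC ⟨k, rfl⟩⟩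

end FiniteRank

/-- A separable Banach space `X` has the bounded approximation property if and only if it has
a frame, i.e. a sequence `(x_n, f_n)` in `X × X*` with `x = ∑_n f_n(x) x_n` in norm for
every `x ∈ X`. -/
theorem bap_iff_exists_frame
    {X : Type*} [NormedAddCommGroup X] [NormedSpace ℂ X] [CompleteSpace X]
    [TopologicalSpace.SeparableSpace X] :
    (∃ Φ : ℕ → X →L[ℂ] X,
      (∀ k, FiniteDimensional ℂ (LinearMap.range (Φ k : X →ₗ[ℂ] X))) ∧
      (∃ C : ℝ, ∀ k, ‖Φ k‖ ≤ C) ∧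
      (∀ x : X, Tendsto (fun k => Φ k x) atTop (nhds x))) ↔
    (∃ (x : ℕ → X) (f : ℕ → (X →L[ℂ] ℂ)),
      ∀ v : X,
        Tendsto (fun N => ∑ n ∈ Finset.range N, f n v • x n) atTop (nhds v)) := by
  constructor
  · rintro ⟨Φ, hfin, -, hlim⟩
    exact exists_frame_of_tendsto_finiteRank Φ hfin hlim
  · rintro ⟨x, f, hf⟩
    exact exists_bounded_finiteRank_of_frame x f hf
end

section
/- A separable C*-algebra A has the completely bounded approximation property if and only if A has a cb-frame, i.e., a sequence (x_n, f_n) in A × A* such that x = ∑_{n=1}^∞ f_n(x) x_n in norm for every x ∈ A and the partial-sum operators S_m(x) = ∑_{n=1}^m f_n(x) x_n satisfy sup_m ‖S_m‖_cb < ∞. -/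
open Filter

lemma le_of_forall_pow_two_pow_le {x y N : ℝ} (hy : 0 ≤ y)
    (h : ∀ k : ℕ, x ^ 2 ^ k ≤ N * y ^ 2 ^ k) : x ≤ y := by
  by_contra! hlt
  rcases hy.eq_or_lt with rfl | hy
  · have := h 0
    simp at this
    exact this.not_gt hlt
  · have h1 : 1 < x / y := (one_lt_div hy).2 hlt
    obtain ⟨k, hk⟩ := pow_unbounded_of_one_lt N h1
    have h2 : (x / y) ^ 2 ^ k ≤ N := by
      rw [div_pow, div_le_iff₀ (by positivity)]; exact h k
    exact hk.not_ge ((pow_le_pow_right₀ h1.le k.lt_two_pow_self.le).trans h2)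

/-- A C*-norm, not assumed complete, on a complex *-algebra. -/
structure IsCStarNorm {B : Type*} [NonUnitalRing B] [StarRing B] [Module ℂ B]
    (p : B → ℝ) : Prop where
  add_le : ∀ x y, p (x + y) ≤ p x + p y
  smul : ∀ (c : ℂ) x, p (c • x) = ‖c‖ * p x
  mul_le : ∀ x y, p (x * y) ≤ p x * p y
  star_mul_self : ∀ x, p (star x * x) = p x ^ 2
  pos : ∀ x, x ≠ 0 → 0 < p x

namespace IsCStarNorm

section General

variable {B : Type*} [NonUnitalRing B] [StarRing B] [Module ℂ B] {p : B → ℝ}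

lemma map_zero (hp : IsCStarNorm p) : p 0 = 0 := by
  simpa using hp.smul 0 0

lemma nonneg (hp : IsCStarNorm p) (x : B) : 0 ≤ p x := by
  rcases eq_or_ne x 0 with rfl | hx
  · exact hp.map_zero.ge
  · exact (hp.pos x hx).le

lemma map_star (hp : IsCStarNorm p) (x : B) : p (star x) = p x := by
  have key : ∀ y : B, p y ≤ p (star y) := by
    intro y
    have h := hp.mul_le (star y) y
    rw [hp.star_mul_self, sq] at h
    rcases (hp.nonneg y).eq_or_lt with h0 | h0
    · rw [← h0]; exact hp.nonneg _
    · exact le_of_mul_le_mul_right h h0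
  exact le_antisymm (by simpa using key (star x)) (key x)

lemma sum_le (hp : IsCStarNorm p) {ι : Type*} (s : Finset ι) (f : ι → B) :
    p (∑ i ∈ s, f i) ≤ ∑ i ∈ s, p (f i) := by
  classical
  induction s using Finset.induction_on with
  | empty => simp [hp.map_zero]
  | insert i s hi ih =>
    rw [Finset.sum_insert hi, Finset.sum_insert hi]
    exact (hp.add_le _ _).trans (by gcongr)

end General

section CStarAlgebra

variable {A : Type*} [NonUnitalCStarAlgebra A] {p : A → ℝ}

/-- The element `√(1 - h²) - 1`, for which `h + i (1 + w)` is a unitary of the unitization. -/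
lemma _root_.IsSelfAdjoint.exists_unitary_part {h : A} (hh : IsSelfAdjoint h) (h1 : ‖h‖ ≤ 1) :
    ∃ w : A, IsSelfAdjoint w ∧ Commute w h ∧ h * h + w * w + w + w = 0 := by
  let W : ℝ → ℝ := fun t => √(1 - t ^ 2) - 1
  have hW0 : W 0 = 0 := by simp [W]
  have hWc : Continuous W := by fun_prop
  have hid : cfcₙ (fun t : ℝ => t) h = h := cfcₙ_id' ℝ h
  refine ⟨cfcₙ W h, cfcₙ_predicate W h, ?_, ?_⟩
  · have := cfcₙ_commute_cfcₙ W (fun t : ℝ => t) h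
    rwa [hid] at this
  · have c : ∀ {f : ℝ → ℝ}, Continuous f → ContinuousOn f (quasispectrum ℝ h) :=
      fun hf => hf.continuousOn
    have e1 : cfcₙ (fun t : ℝ => t * t) h = h * h := by
      rw [cfcₙ_mul (fun t : ℝ => t) (fun t : ℝ => t) h, hid]
    have e2 : cfcₙ (fun t : ℝ => W t * W t) h = cfcₙ W h * cfcₙ W h :=
      cfcₙ_mul W W h (c hWc) hW0 (c hWc) hW0
    rw [← e1, ← e2,
      ← cfcₙ_add (fun t : ℝ => t * t) (fun t => W t * W t) h (c (by fun_prop)) (by simp)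
        (c (by fun_prop)) (by simp [hW0]),
      ← cfcₙ_add (fun t : ℝ => t * t + W t * W t) W h (c (by fun_prop)) (by simp [hW0])
        (c (by fun_prop)) (by simp [hW0]),
      ← cfcₙ_add (fun t : ℝ => t * t + W t * W t + W t) W h (c (by fun_prop)) (by simp [hW0])
        (c (by fun_prop)) (by simp [hW0]), ← cfcₙ_zero ℝ h]
    refine cfcₙ_congr fun t ht => ?_
    have h2 : |t| ≤ 1 := by
      have := norm_apply_le_norm_cfcₙ (fun t : ℝ => t) h ht
      rw [hid] at this
      exact this.trans h1
    have h3 : 0 ≤ 1 - t ^ 2 := by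
      have := (sq_le_one_iff_abs_le_one t).2 h2
      linarith
    have := Real.mul_self_sqrt h3
    simp only [Pi.zero_apply, W]
    nlinarith

lemma le_one_of_isSelfAdjoint (hp : IsCStarNorm p) {h : A} (hh : IsSelfAdjoint h)
    (h1 : ‖h‖ ≤ 1) : p h ≤ 1 := by
  obtain ⟨w, hws, hwh, hrel⟩ := hh.exists_unitary_part h1
  have key : ∀ c : ℂ, c * c = -1 → star c = -c →
      p (h * h + c • (h + w * h)) = p h := by
    intro c hc hcs
    have : star (h * h + c • (h + w * h)) * (h * h + c • (h + w * h)) = star h * h := by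
      have e1 : star (h * h + c • (h + w * h)) = h * h - c • (h + h * w) := by
        simp only [star_add, star_mul, star_smul, hcs, hh.star_eq, hws.star_eq, neg_smul,
          sub_eq_add_neg]
      have e2 : h * h * (h + w * h) = (h + h * w) * (h * h) := by
        have : h * h * (w * h) = h * w * (h * h) := by
          rw [mul_assoc h w, ← mul_assoc w h h, hwh.eq, mul_assoc h w h, hwh.eq, mul_assoc]
        rw [mul_add, add_mul, this]; simp only [mul_assoc]
      have e3 : h * h * (h * h) + (h + h * w) * (h + w * h) = h * h := by
        have : h * (h * h + w * w + w + w) * h = 0 := by rw [hrel]; simp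
        rw [← sub_eq_zero, ← this]; noncomm_ring
      rw [e1, sub_mul, mul_add, mul_add, smul_mul_assoc, smul_mul_assoc, mul_smul_comm,
        mul_smul_comm, smul_smul, hc, e2, neg_smul, one_smul, hh.star_eq]
      refine Eq.trans ?_ e3
      abel
    have e := hp.star_mul_self (h * h + c • (h + w * h))
    rw [this, hp.star_mul_self] at e
    exact (pow_left_inj₀ (hp.nonneg _) (hp.nonneg _) two_ne_zero).1 e.symm
  have hsum : (2 : ℂ) • (h * h) = (h * h + Complex.I • (h + w * h))
      + (h * h + (-Complex.I) • (h + w * h)) := by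
    rw [neg_smul, two_smul]; abel
  have h4 : 2 * p (h * h) ≤ p h + p h := by
    have := hp.add_le (h * h + Complex.I • (h + w * h)) (h * h + (-Complex.I) • (h + w * h))
    rw [← hsum, hp.smul, key _ (by simp) (by simp), key _ (by simp) (by simp)] at this
    simpa using this
  have h5 := hp.star_mul_self h
  rw [hh.star_eq] at h5
  by_contra! h6
  nlinarith

lemma le_norm_of_isSelfAdjoint (hp : IsCStarNorm p) {h : A} (hh : IsSelfAdjoint h) :
    p h ≤ ‖h‖ := by
  rcases eq_or_ne h 0 with rfl | h0
  · simp [hp.map_zero]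
  have hn : 0 < ‖h‖ := norm_pos_iff.2 h0
  have hsa : IsSelfAdjoint ((((‖h‖⁻¹ : ℝ) : ℂ)) • h) :=
    IsSelfAdjoint.smul (by simp [IsSelfAdjoint]) hh
  have hc : ‖((‖h‖⁻¹ : ℝ) : ℂ)‖ = ‖h‖⁻¹ := by
    rw [Complex.norm_real, norm_inv, norm_norm]
  have := hp.le_one_of_isSelfAdjoint hsa (by rw [norm_smul, hc, inv_mul_cancel₀ hn.ne'])
  rwa [hp.smul, hc, inv_mul_le_iff₀ hn, mul_one] at this

lemma norm_le_of_isSelfAdjoint (hp : IsCStarNorm p) {h : A} (hh : IsSelfAdjoint h) :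
    ‖h‖ ≤ p h := by
  by_contra! hlt
  obtain ⟨s, hs, hsh⟩ := exists_between hlt
  have hs0 : 0 < s := (hp.nonneg h).trans_lt hs
  let M : ℝ → ℝ := fun t => max |t| s
  have hM : ∀ t, 0 < M t := fun t => hs0.trans_le (le_max_right _ _)
  let g : ℝ → ℝ := fun t => M t - s
  let k : ℝ → ℝ := fun t => t / M t ^ 2
  have hMc : Continuous M := by fun_prop
  have hgc : Continuous g := by fun_prop
  have hkc : Continuous k := by
    refine continuous_id.div (by fun_prop) fun t => (pow_pos (hM t) 2).ne'
  have hg0 : g 0 = 0 := by simp [g, M, hs0.le]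
  have hk0 : k 0 = 0 := by simp [k]
  have hid : cfcₙ (fun t : ℝ => t) h = h := cfcₙ_id' ℝ h
  have hkg : cfcₙ k h * h * cfcₙ g h = cfcₙ g h := by
    have e1 : cfcₙ (fun t => k t * t) h = cfcₙ k h * h := by
      rw [cfcₙ_mul k (fun t => t) h hkc.continuousOn hk0 continuous_id.continuousOn rfl, hid]
    rw [← e1, ← cfcₙ_mul (fun t => k t * t) g h (by fun_prop) (by simp) hgc.continuousOn hg0]
    congr 1
    funext t
    rcases le_total |t| s with hts | hts
    · simp [g, M, hts]
    · have hMt : M t = |t| := max_eq_left hts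
      have ht : t ≠ 0 := abs_pos.1 (hs0.trans_le hts)
      simp only [k, hMt, sq_abs]
      field_simp
  have hgne : cfcₙ g h ≠ 0 := by
    intro hg
    refine hsh.not_ge ?_
    rw [← hid]
    refine norm_cfcₙ_le fun t ht => ?_
    have := norm_apply_le_norm_cfcₙ g h ht hgc.continuousOn hg0
    rw [hg, norm_zero, norm_le_zero_iff] at this
    have h7 : M t = s := sub_eq_zero.1 this
    rw [Real.norm_eq_abs, ← h7]
    exact le_max_left _ _
  have hkn : p (cfcₙ k h) ≤ s⁻¹ := by
    refine (hp.le_norm_of_isSelfAdjoint (cfcₙ_predicate k h)).trans (norm_cfcₙ_le fun t _ => ?_)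
    have h8 : |t| ≤ M t := le_max_left _ _
    have h9 : s ≤ M t := le_max_right _ _
    have := hM t
    rw [Real.norm_eq_abs, abs_div, abs_pow, abs_of_pos this, div_le_iff₀ (by positivity)]
    calc |t| ≤ M t := h8
      _ ≤ s⁻¹ * M t * M t := by
        refine le_mul_of_one_le_left this.le ?_
        rw [inv_mul_eq_div, one_le_div hs0]; exact h9
      _ = s⁻¹ * M t ^ 2 := by ring
  have h10 : p (cfcₙ g h) ≤ s⁻¹ * p h * p (cfcₙ g h) := by
    calc p (cfcₙ g h) = p (cfcₙ k h * h * cfcₙ g h) := by rw [hkg]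
      _ ≤ p (cfcₙ k h) * p h * p (cfcₙ g h) :=
        (hp.mul_le _ _).trans (mul_le_mul_of_nonneg_right (hp.mul_le _ _) (hp.nonneg _))
      _ ≤ _ := by
        have := hp.nonneg h
        have := hp.nonneg (cfcₙ g h)
        gcongr
  have h11 : 1 ≤ s⁻¹ * p h := (le_mul_iff_one_le_left (hp.pos _ hgne)).1 h10
  rw [inv_mul_eq_div, one_le_div hs0] at h11
  exact hs.not_ge h11

/-- Uniqueness of the C*-norm on a C*-algebra. -/
lemma eq_norm (hp : IsCStarNorm p) (a : A) : p a = ‖a‖ := by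
  have hsa := IsSelfAdjoint.star_mul_self a
  have := (hp.le_norm_of_isSelfAdjoint hsa).antisymm (hp.norm_le_of_isSelfAdjoint hsa)
  rw [hp.star_mul_self, CStarRing.norm_star_mul_self, ← sq] at this
  exact (pow_left_inj₀ (hp.nonneg _) (norm_nonneg _) two_ne_zero).1 this

end CStarAlgebra
section Matrix

variable {A : Type*} [NonUnitalCStarAlgebra A] {n : Type*} [Fintype n] [DecidableEq n]
  {p : Matrix n n A → ℝ}

lemma comp_single (hp : IsCStarNorm p) (i : n) :
    IsCStarNorm fun a : A => p (Matrix.single i i a) where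
  add_le x y := by rw [Matrix.single_add]; exact hp.add_le _ _
  smul c x := by rw [← Matrix.smul_single]; exact hp.smul _ _
  mul_le x y := by
    simpa only [Matrix.single_mul_single_same] using
      hp.mul_le (Matrix.single i i x) (Matrix.single i i y)
  star_mul_self x := by
    rw [← hp.star_mul_self, Matrix.star_eq_conjTranspose, Matrix.conjTranspose_single,
      Matrix.single_mul_single_same]
  pos x hx := hp.pos _ fun h => hx (by simpa using congrFun₂ h i i)

lemma map_single (hp : IsCStarNorm p) (i j : n) (a : A) : p (Matrix.single i j a) = ‖a‖ := by
  have h := hp.star_mul_self (Matrix.single i j a)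
  rw [Matrix.star_eq_conjTranspose, Matrix.conjTranspose_single, Matrix.single_mul_single_same,
    (hp.comp_single j).eq_norm, CStarRing.norm_star_mul_self, ← sq] at h
  exact ((pow_left_inj₀ (norm_nonneg _) (hp.nonneg _) two_ne_zero).1 h).symm

open scoped Matrix.Norms.L2Operator

lemma _root_.Matrix.norm_entry_le_l2_opNorm (F : Matrix n n ℂ) (i j : n) : ‖F i j‖ ≤ ‖F‖ := by
  have h := F.l2_opNorm_mulVec (EuclideanSpace.single j 1)
  have h2 := PiLp.norm_apply_le ((EuclideanSpace.equiv n ℂ).symm <|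
    F.mulVec (EuclideanSpace.single j (1 : ℂ))) i
  simpa using h2.trans h

/-- The norm of the elementary tensor `F ⊗ e`. -/
lemma map_tensor_le (hp : IsCStarNorm p) (F : Matrix n n ℂ) (e : A) :
    p (Matrix.of fun i j => F i j • e) ≤ ‖F‖ * ‖e‖ := by
  refine le_of_forall_pow_two_pow_le (N := Fintype.card n * Fintype.card n) (by positivity)
    fun k => ?_
  induction k generalizing F e with
  | zero =>
    rw [pow_zero, pow_one, pow_one,
      Matrix.matrix_eq_sum_single (Matrix.of fun i j => F i j • e)]
    calc _ ≤ ∑ i : n, ∑ j : n, p (Matrix.single i j (F i j • e)) :=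
          (hp.sum_le _ _).trans (Finset.sum_le_sum fun i _ => hp.sum_le _ _)
      _ ≤ ∑ i : n, ∑ j : n, ‖F‖ * ‖e‖ := by
        gcongr with i _ j _
        rw [hp.map_single, norm_smul]
        gcongr
        exact F.norm_entry_le_l2_opNorm i j
      _ = _ := by simp [mul_assoc]
  | succ k ih =>
    have h : star (Matrix.of fun i j => F i j • e) * (Matrix.of fun i j => F i j • e)
        = Matrix.of fun i j => (star F * F) i j • (star e * e) := by
      ext i j
      simp [Matrix.mul_apply, Matrix.star_eq_conjTranspose, Finset.sum_smul, smul_mul_smul_comm]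
    have h1 := ih (star F * F) (star e * e)
    rw [← h, hp.star_mul_self, CStarRing.norm_star_mul_self, CStarRing.norm_star_mul_self] at h1
    rw [pow_succ', pow_mul, pow_mul, mul_pow _ _ 2, sq ‖F‖, sq ‖e‖]
    exact h1

lemma norm_sum_smul_le (hp : IsCStarNorm p) (ξ η : EuclideanSpace ℂ n) (u : Matrix n n A) :
    ‖∑ i, ∑ j, (star (η i) * ξ j) • u i j‖ ≤ ‖η‖ * p u * ‖ξ‖ := by
  rcases isEmpty_or_nonempty n with hn | ⟨⟨o⟩⟩
  · simp
    have := hp.nonneg u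
    positivity
  set v := ∑ i, ∑ j, (star (η i) * ξ j) • u i j with hv
  let X : EuclideanSpace ℂ n → A → Matrix n n A := fun ζ a =>
    Matrix.of fun i j => if j = o then ζ i • a else 0
  have hX : ∀ ζ a, p (X ζ a) = ‖ζ‖ * ‖a‖ := by
    intro ζ a
    have h : star (X ζ a) * X ζ a
        = Matrix.single o o (((‖ζ‖ ^ 2 : ℝ) : ℂ) • (star a * a)) := by
      ext i j
      rw [EuclideanSpace.norm_sq_eq]
      by_cases hi : i = o <;> by_cases hj : j = o <;>
        simp [X, Matrix.mul_apply, Matrix.star_eq_conjTranspose, hi, hj, Ne.symm, Matrix.single,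
          eq_comm, smul_mul_smul_comm, Finset.sum_smul, Complex.conj_mul']
    have h1 := hp.star_mul_self (X ζ a)
    rw [h, hp.map_single, norm_smul, CStarRing.norm_star_mul_self, Complex.norm_real,
      Real.norm_of_nonneg (by positivity), ← sq, ← mul_pow] at h1
    exact ((pow_left_inj₀ (by positivity) (hp.nonneg _) two_ne_zero).1 h1).symm
  have hprod : star (X η v) * u * X ξ (star v * v)
      = Matrix.single o o (star v * v * (star v * v)) := by
    have hvv : star v * v * (star v * v) =
        star v * (∑ i, ∑ j, (star (η i) * ξ j) • u i j) * (star v * v) := by rw [← hv]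
    rw [hvv]
    ext i j
    rcases eq_or_ne o i with rfl | hi <;> rcases eq_or_ne o j with rfl | hj
    · simp only [X, Matrix.mul_apply, Matrix.star_eq_conjTranspose, Matrix.conjTranspose_apply,
        Matrix.of_apply, if_true, Matrix.single_apply_same, Finset.mul_sum, Finset.sum_mul]
      rw [Finset.sum_comm]
      refine Finset.sum_congr rfl fun i _ => Finset.sum_congr rfl fun j _ => ?_
      simp only [star_smul, smul_mul_assoc, mul_smul_comm, smul_smul]
      rw [mul_comm]
    · simp [X, Matrix.mul_apply, Matrix.single, hj, hj.symm]
    · simp [X, Matrix.mul_apply, Matrix.star_eq_conjTranspose, Matrix.single, hi, hi.symm]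
    · simp [X, Matrix.mul_apply, Matrix.single, hj, hj.symm]
  have h2 : ‖v‖ ^ 4 ≤ ‖η‖ * ‖v‖ * p u * (‖ξ‖ * ‖v‖ ^ 2) := by
    calc ‖v‖ ^ 4 = p (star (X η v) * u * X ξ (star v * v)) := by
          have hsa : star (star v * v) = star v * v := (IsSelfAdjoint.star_mul_self v).star_eq
          have : ‖star v * v * (star v * v)‖ = ‖star v * v‖ * ‖star v * v‖ := by
            nth_rewrite 1 [← hsa]; exact CStarRing.norm_star_mul_self
          rw [hprod, hp.map_single, this, CStarRing.norm_star_mul_self]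
          ring
      _ ≤ p (star (X η v)) * p u * p (X ξ (star v * v)) :=
        (hp.mul_le _ _).trans (mul_le_mul_of_nonneg_right (hp.mul_le _ _) (hp.nonneg _))
      _ = _ := by
        rw [hp.map_star, hX, hX, CStarRing.norm_star_mul_self, sq]
  rcases (norm_nonneg v).eq_or_lt with h0 | h0
  · rw [← h0]
    have := hp.nonneg u
    positivity
  · have h3 : 0 < ‖v‖ ^ 3 := by positivity
    refine le_of_mul_le_mul_right ?_ h3
    linarith

lemma map_rankOne_le (hp : IsCStarNorm p) (f : A →L[ℂ] ℂ) (e : A) (u : Matrix n n A) :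
    p (Matrix.of fun i j => f (u i j) • e) ≤ ‖f‖ * ‖e‖ * p u := by
  have hu := hp.nonneg u
  refine (hp.map_tensor_le (Matrix.of fun i j => f (u i j)) e).trans ?_
  have : ‖Matrix.of fun i j => f (u i j)‖ ≤ ‖f‖ * p u := by
    rw [Matrix.l2_opNorm_def]
    refine ContinuousLinearMap.opNorm_le_bound _ (by positivity) fun ξ => ?_
    set η := (Matrix.toEuclideanLin.trans LinearMap.toContinuousLinearMap
      (Matrix.of fun i j => f (u i j))) ξ with hη
    have h1 : inner ℂ η η = f (∑ i, ∑ j, (star (η i) * ξ j) • u i j) := by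
      rw [PiLp.inner_apply]
      simp only [map_sum, map_smul]
      refine Finset.sum_congr rfl fun i _ => ?_
      have : η i = ∑ j, f (u i j) * ξ j := rfl
      rw [RCLike.inner_apply']
      nth_rewrite 2 [this]
      rw [Finset.mul_sum]
      refine Finset.sum_congr rfl fun j _ => ?_
      simp only [smul_eq_mul, RCLike.star_def]
      ring
    have h2 : ‖η‖ * ‖η‖ ≤ ‖f‖ * p u * ‖ξ‖ * ‖η‖ := by
      calc ‖η‖ * ‖η‖ = ‖f (∑ i, ∑ j, (star (η i) * ξ j) • u i j)‖ := by
            rw [← h1, inner_self_eq_norm_sq_to_K]; simp [sq]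
        _ ≤ ‖f‖ * (‖η‖ * p u * ‖ξ‖) :=
          (f.le_opNorm _).trans (by gcongr; exact hp.norm_sum_smul_le ξ η u)
        _ = _ := by ring
    rcases (norm_nonneg η).eq_or_lt with h0 | h0
    · rw [← h0]; positivity
    · exact le_of_mul_le_mul_right h2 h0
  calc _ ≤ ‖f‖ * p u * ‖e‖ := by gcongr
    _ = _ := by ring

end Matrix

end IsCStarNorm

/-- The amplifications of `g` are bounded by `C`, for the given family of matrix norms. -/
def CBBound {A : Type*} (mnorm : ∀ n : ℕ, Matrix (Fin n) (Fin n) A → ℝ) (C : ℝ) (g : A → A) :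
    Prop :=
  ∀ n (u : Matrix (Fin n) (Fin n) A), mnorm n (Matrix.of fun i j => g (u i j)) ≤ C * mnorm n u

namespace CBBound

lemma congr {A : Type*} {mnorm : ∀ n : ℕ, Matrix (Fin n) (Fin n) A → ℝ} {C : ℝ} {g h : A → A}
    (hg : CBBound mnorm C g) (hgh : ∀ a, h a = g a) : CBBound mnorm C h := by
  rwa [funext hgh]

variable {A : Type*} [NonUnitalCStarAlgebra A] {mnorm : ∀ n : ℕ, Matrix (Fin n) (Fin n) A → ℝ}
  {C D : ℝ} {g h : A → A}

lemma mono (hm : ∀ n, IsCStarNorm (mnorm n)) (hg : CBBound mnorm C g) (hCD : C ≤ D) :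
    CBBound mnorm D g := fun n u =>
  (hg n u).trans (mul_le_mul_of_nonneg_right hCD ((hm n).nonneg u))

lemma zero (hm : ∀ n, IsCStarNorm (mnorm n)) : CBBound mnorm 0 fun _ : A => 0 := fun n u => by
  rw [zero_mul]
  exact (hm n).map_zero.le

lemma add (hm : ∀ n, IsCStarNorm (mnorm n)) (hg : CBBound mnorm C g) (hh : CBBound mnorm D h) :
    CBBound mnorm (C + D) fun a => g a + h a := fun n u => by
  rw [add_mul]
  exact ((hm n).add_le (Matrix.of fun i j => g (u i j)) (Matrix.of fun i j => h (u i j))).trans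
    (add_le_add (hg n u) (hh n u))

lemma smul (hm : ∀ n, IsCStarNorm (mnorm n)) (hg : CBBound mnorm C g) (c : ℂ) :
    CBBound mnorm (‖c‖ * C) fun a => c • g a := fun n u => by
  rw [mul_assoc]
  exact ((hm n).smul c (Matrix.of fun i j => g (u i j))).le.trans
    (mul_le_mul_of_nonneg_left (hg n u) (norm_nonneg c))

lemma sum_rankOne (hm : ∀ n, IsCStarNorm (mnorm n)) (x : ℕ → A) (f : ℕ → A →L[ℂ] ℂ) (s : ℕ) :
    CBBound mnorm (∑ j ∈ Finset.range s, ‖f j‖ * ‖x j‖)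
      fun a => ∑ j ∈ Finset.range s, f j a • x j := by
  induction s with
  | zero => simpa using zero hm
  | succ s ih =>
    simp only [Finset.sum_range_succ]
    exact ih.add hm fun n u => (hm n).map_rankOne_le (f s) (x s) u

end CBBound

lemma norm_sum_rankOne_le {E : Type*} [NormedAddCommGroup E] [NormedSpace ℂ E] (x : ℕ → E)
    (f : ℕ → E →L[ℂ] ℂ) (s : ℕ) (a : E) :
    ‖∑ j ∈ Finset.range s, f j a • x j‖ ≤ (∑ j ∈ Finset.range s, ‖f j‖ * ‖x j‖) * ‖a‖ := by
  rw [Finset.sum_mul]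
  refine norm_sum_le_of_le _ fun j _ => ?_
  rw [norm_smul, mul_right_comm]
  gcongr
  exact (f j).le_opNorm a

lemma ContinuousLinearMap.exists_eq_sum_rankOne {E : Type*} [NormedAddCommGroup E]
    [NormedSpace ℂ E] (T : E →L[ℂ] E)
    (hT : FiniteDimensional ℂ (LinearMap.range (T : E →ₗ[ℂ] E))) :
    ∃ (d : ℕ) (x : ℕ → E) (f : ℕ → E →L[ℂ] ℂ), 0 < d ∧
      ∀ a, T a = ∑ j ∈ Finset.range d, f j a • x j := by
  set R := LinearMap.range (T : E →ₗ[ℂ] E)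
  let b := Module.finBasis ℂ R
  let T' : E →L[ℂ] R := T.codRestrict R fun a => LinearMap.mem_range_self (T : E →ₗ[ℂ] E) a
  let d := Module.finrank ℂ R
  refine ⟨d + 1, fun j => if h : j < d then (b ⟨j, h⟩ : E) else 0,
    fun j => if h : j < d then (LinearMap.toContinuousLinearMap (b.coord ⟨j, h⟩)).comp T' else 0,
    d.succ_pos, fun a => ?_⟩
  rw [Finset.sum_range_succ, Finset.sum_range]
  have h : ((∑ i, b.repr (T' a) i • b i : R) : E) = T a := by rw [b.sum_repr]; rfl
  rw [Submodule.coe_sum] at h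
  simpa [T'] using h.symm

lemma Finset.sum_range_mul_add_mod {M : Type*} [AddCommMonoid M] (c : ℕ → M) (d q s : ℕ)
    (hs : s ≤ d) :
    ∑ j ∈ Finset.range (d * q + s), c (j % d)
      = q • ∑ j ∈ Finset.range d, c j + ∑ j ∈ Finset.range s, c j := by
  have h1 : ∀ t ≤ d, ∀ r, ∑ j ∈ Finset.range t, c ((d * r + j) % d)
      = ∑ j ∈ Finset.range t, c j := fun t ht r =>
    Finset.sum_congr rfl fun j hj => by
      rw [Nat.mul_add_mod, Nat.mod_eq_of_lt ((Finset.mem_range.1 hj).trans_le ht)]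
  have h2 : ∑ j ∈ Finset.range (d * q), c (j % d) = q • ∑ j ∈ Finset.range d, c j := by
    induction q with
    | zero => simp
    | succ q ih => rw [Nat.mul_succ, Finset.sum_range_add, ih, h1 d le_rfl, succ_nsmul]
  rw [Finset.sum_range_add, h2, h1 s hs]

/-- A finite rank operator is a sum of rank one operators whose partial sums are, up to a small
error, multiples of the operator by scalars in `[0, 1]`. -/
lemma exists_rankOne_block {A : Type*} [NonUnitalCStarAlgebra A]
    {mnorm : ∀ n : ℕ, Matrix (Fin n) (Fin n) A → ℝ} (hm : ∀ n, IsCStarNorm (mnorm n))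
    (T : A →L[ℂ] A) (hT : FiniteDimensional ℂ (LinearMap.range (T : A →ₗ[ℂ] A)))
    {ε : ℝ} (hε : 0 < ε) :
    ∃ (L : ℕ) (x : ℕ → A) (f : ℕ → A →L[ℂ] ℂ), 0 < L ∧
      (∀ a, ∑ j ∈ Finset.range L, f j a • x j = T a) ∧
      ∀ J ≤ L, ∃ (r : ℝ) (g : A → A), 0 ≤ r ∧ r ≤ 1 ∧ CBBound mnorm ε g ∧
        (∀ a, ‖g a‖ ≤ ε * ‖a‖) ∧
        ∀ a, ∑ j ∈ Finset.range J, f j a • x j = (r : ℂ) • T a + g a := by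
  obtain ⟨d, x, f, hd, hTx⟩ := T.exists_eq_sum_rankOne hT
  let K : ℕ → ℝ := fun s => ∑ j ∈ Finset.range s, ‖f j‖ * ‖x j‖
  obtain ⟨N, hN⟩ := exists_nat_gt (K d / ε)
  have hK0 : 0 ≤ K d := Finset.sum_nonneg fun _ _ => by positivity
  have hN0 : (0 : ℝ) < N := (div_nonneg hK0 hε.le).trans_lt hN
  have hN1 : 0 < N := by exact_mod_cast hN0
  have hbound : ∀ s ≤ d, ‖((N : ℂ))⁻¹‖ * K s ≤ ε := by
    intro s hs
    have h1 : K s ≤ K d := Finset.sum_le_sum_of_subset_of_nonneg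
      (Finset.range_subset_range.2 hs) fun _ _ _ => by positivity
    rw [norm_inv, Complex.norm_natCast, inv_mul_le_iff₀ hN0]
    rw [div_lt_iff₀ hε] at hN
    linarith
  have hsum : ∀ q s, s ≤ d → ∀ a,
      ∑ j ∈ Finset.range (d * q + s), f (j % d) a • (N : ℂ)⁻¹ • x (j % d)
      = ((q / N : ℝ) : ℂ) • T a + (N : ℂ)⁻¹ • ∑ j ∈ Finset.range s, f j a • x j := by
    intro q s hs a
    rw [Finset.sum_range_mul_add_mod (fun j => f j a • (N : ℂ)⁻¹ • x j) d q s hs]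
    simp only [smul_comm _ ((N : ℂ)⁻¹), ← Finset.smul_sum]
    rw [← hTx, ← Nat.cast_smul_eq_nsmul ℂ, smul_smul, div_eq_inv_mul]
    push_cast
    rfl
  refine ⟨d * N, fun j => (N : ℂ)⁻¹ • x (j % d), fun j => f (j % d), by positivity, fun a => ?_,
    fun J hJ => ?_⟩
  · have := hsum N 0 (Nat.zero_le _) a
    rw [div_self hN0.ne'] at this
    simpa using this
  · have hs : J % d ≤ d := (Nat.mod_lt J hd).le
    refine ⟨((J / d : ℕ) : ℝ) / N, fun a => (N : ℂ)⁻¹ • ∑ j ∈ Finset.range (J % d), f j a • x j,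
      by positivity, ?_, ((CBBound.sum_rankOne hm x f (J % d)).smul hm _).mono hm (hbound _ hs),
      fun a => ?_, fun a => ?_⟩
    · rw [div_le_one hN0]
      exact_mod_cast Nat.div_le_of_le_mul hJ
    · rw [norm_smul]
      calc _ ≤ ‖(N : ℂ)⁻¹‖ * (K (J % d) * ‖a‖) := by
            gcongr; exact norm_sum_rankOne_le x f _ a
        _ ≤ ε * ‖a‖ := by
          rw [← mul_assoc]; gcongr; exact hbound _ hs
    · rw [← hsum _ _ hs a, Nat.div_add_mod]

/-- The successor of a position `(k, j)` when blocks of length `L k` are listed in order. -/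
def blockStep (L : ℕ → ℕ) (s : ℕ × ℕ) : ℕ × ℕ :=
  if s.2 + 1 < L s.1 then (s.1, s.2 + 1) else (s.1 + 1, 0)

/-- The position of the `m`-th term in the concatenation of blocks of length `L k`. -/
def blockPos (L : ℕ → ℕ) (m : ℕ) : ℕ × ℕ := (blockStep L)^[m] (0, 0)

lemma blockPos_succ (L : ℕ → ℕ) (m : ℕ) : blockPos L (m + 1) = blockStep L (blockPos L m) :=
  Function.iterate_succ_apply' _ _ _

lemma blockPos_snd_lt {L : ℕ → ℕ} (hL : ∀ k, 0 < L k) (m : ℕ) :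
    (blockPos L m).2 < L (blockPos L m).1 := by
  induction m with
  | zero => exact hL 0
  | succ m ih =>
    rw [blockPos_succ, blockStep]
    split_ifs with h
    · exact h
    · exact hL _

lemma sum_blockPos {M : Type*} [AddCommMonoid M] {L : ℕ → ℕ} (hL : ∀ k, 0 < L k)
    (c : ℕ × ℕ → M) (m : ℕ) :
    ∑ t ∈ Finset.range m, c (blockPos L t)
      = ∑ k ∈ Finset.range (blockPos L m).1, ∑ j ∈ Finset.range (L k), c (k, j)
        + ∑ j ∈ Finset.range (blockPos L m).2, c ((blockPos L m).1, j) := by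
  induction m with
  | zero => simp [blockPos]
  | succ m ih =>
    have hlt := blockPos_snd_lt hL m
    rw [Finset.sum_range_succ, ih, blockPos_succ, blockStep]
    split_ifs with h
    · rw [Finset.sum_range_succ, add_assoc]
    · have : L (blockPos L m).1 = (blockPos L m).2 + 1 := by omega
      rw [Finset.sum_range_succ, this, Finset.sum_range_succ, add_assoc]
      simp

lemma tendsto_blockPos_fst {L : ℕ → ℕ} (hL : ∀ k, 0 < L k) :
    Tendsto (fun m => (blockPos L m).1) atTop atTop := by
  refine tendsto_atTop.2 fun K => ?_
  filter_upwards [eventually_ge_atTop (∑ k ∈ Finset.range K, L k)] with m hK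
  by_contra! hlt
  have h1 := sum_blockPos hL (fun _ => 1) m
  simp only [Finset.sum_const, Finset.card_range, smul_eq_mul, mul_one] at h1
  have h2 := blockPos_snd_lt hL m
  have h3 : ∑ k ∈ Finset.range ((blockPos L m).1 + 1), L k ≤ ∑ k ∈ Finset.range K, L k :=
    Finset.sum_le_sum_of_subset (Finset.range_subset_range.2 hlt)
  rw [Finset.sum_range_succ] at h3
  omega

lemma exists_cbFrame_of_cbap {A : Type*} [NonUnitalCStarAlgebra A]
    {mnorm : ∀ n : ℕ, Matrix (Fin n) (Fin n) A → ℝ} (hm : ∀ n, IsCStarNorm (mnorm n))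
    (Φ : ℕ → A →L[ℂ] A)
    (hfin : ∀ k, FiniteDimensional ℂ (LinearMap.range (Φ k : A →ₗ[ℂ] A)))
    {C : ℝ} (hC : ∀ k, CBBound mnorm C (Φ k))
    (hΦ : ∀ a, Tendsto (fun k => Φ k a) atTop (nhds a)) :
    ∃ (x : ℕ → A) (f : ℕ → (A →L[ℂ] ℂ)),
      (∀ a : A,
        Tendsto (fun N => ∑ t ∈ Finset.range N, f t a • x t) atTop (nhds a)) ∧
      (∃ C : ℝ, ∀ m, CBBound mnorm C fun a => ∑ t ∈ Finset.range m, f t a • x t) := by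
  obtain ⟨Θ, hΘ0, hΘsucc⟩ : ∃ Θ : ℕ → A →L[ℂ] A, Θ 0 = 0 ∧ ∀ k, Θ (k + 1) = Φ k :=
    ⟨fun k => Nat.casesOn k 0 Φ, rfl, fun _ => rfl⟩
  have hΘ : ∀ k, CBBound mnorm |C| (Θ k) := by
    rintro (_ | k)
    · rw [hΘ0]
      exact (CBBound.zero hm).mono hm (abs_nonneg C)
    · rw [hΘsucc]
      exact (hC k).mono hm (le_abs_self C)
  have hΘfin : ∀ k, FiniteDimensional ℂ (LinearMap.range (Θ k : A →ₗ[ℂ] A)) := by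
    rintro (_ | k)
    · rw [hΘ0, ContinuousLinearMap.toLinearMap_zero, LinearMap.range_zero]
      infer_instance
    · rw [hΘsucc]
      exact hfin k
  have hΘlim : ∀ a, Tendsto (fun k => Θ k a) atTop (nhds a) := fun a =>
    (tendsto_add_atTop_iff_nat 1).1 (by simpa only [hΘsucc] using hΦ a)
  let Ψ : ℕ → A →L[ℂ] A := fun k => Θ (k + 1) - Θ k
  have hΨfin : ∀ k, FiniteDimensional ℂ (LinearMap.range (Ψ k : A →ₗ[ℂ] A)) := fun k => by
    have := hΘfin k
    have := hΘfin (k + 1)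
    refine Submodule.finiteDimensional_of_le (S₂ := LinearMap.range (Θ (k + 1) : A →ₗ[ℂ] A) ⊔
      LinearMap.range (Θ k : A →ₗ[ℂ] A)) ?_
    rintro _ ⟨a, rfl⟩
    exact Submodule.sub_mem_sup (LinearMap.mem_range_self _ a) (LinearMap.mem_range_self _ a)
  have hΨ : ∀ k, CBBound mnorm (2 * |C|) (Ψ k) := fun k => by
    have h := (hΘ (k + 1)).add hm ((hΘ k).smul hm (-1))
    refine (h.mono hm (D := 2 * |C|) (by simp [two_mul])).congr fun a => ?_
    simp [Ψ, sub_eq_add_neg]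
  have hε : ∀ k : ℕ, (0 : ℝ) < 1 / (k + 1) := fun k => by positivity
  choose L x f hL hsum hpart using fun k => exists_rankOne_block hm (Ψ k) (hΨfin k) (hε k)
  have hS : ∀ m, ∃ (r : ℝ) (g : A → A), 0 ≤ r ∧ r ≤ 1 ∧
      CBBound mnorm (1 / ((blockPos L m).1 + 1)) g ∧
      (∀ a, ‖g a‖ ≤ 1 / ((blockPos L m).1 + 1) * ‖a‖) ∧
      ∀ a, ∑ t ∈ Finset.range m,
          f (blockPos L t).1 (blockPos L t).2 a • x (blockPos L t).1 (blockPos L t).2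
        = Θ (blockPos L m).1 a + ((r : ℂ) • Ψ (blockPos L m).1 a + g a) := by
    intro m
    obtain ⟨r, g, hr0, hr1, hg, hg', hrg⟩ := hpart (blockPos L m).1 (blockPos L m).2
      (blockPos_snd_lt hL m).le
    refine ⟨r, g, hr0, hr1, hg, hg', fun a => ?_⟩
    rw [sum_blockPos hL (fun s => f s.1 s.2 a • x s.1 s.2) m, hrg]
    simp only [hsum]
    congr 1
    have : ∀ k, Ψ k a = Θ (k + 1) a - Θ k a := fun k => rfl
    simp only [this, Finset.sum_range_sub (fun k => Θ k a)]
    simp [hΘ0]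
  refine ⟨fun t => x (blockPos L t).1 (blockPos L t).2,
    fun t => f (blockPos L t).1 (blockPos L t).2, fun a => ?_, |C| + (2 * |C| + 1), fun m => ?_⟩
  · have hk := tendsto_blockPos_fst hL
    have h1 : Tendsto (fun k => ‖Θ k a - a‖) atTop (nhds 0) :=
      tendsto_iff_norm_sub_tendsto_zero.1 (hΘlim a)
    have h2 : Tendsto (fun k => ‖Ψ k a‖) atTop (nhds 0) := by
      have := (((tendsto_add_atTop_iff_nat 1).2 (hΘlim a)).sub (hΘlim a)).norm
      rwa [sub_self, norm_zero] at this
    have h3 : Tendsto (fun k : ℕ => 1 / ((k : ℝ) + 1) * ‖a‖) atTop (nhds 0) := by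
      simpa using tendsto_one_div_add_atTop_nhds_zero_nat.mul_const ‖a‖
    have h4 := ((h1.add (h2.add h3)).comp hk)
    simp only [add_zero] at h4
    refine tendsto_iff_norm_sub_tendsto_zero.2
      (squeeze_zero (fun _ => norm_nonneg _) (fun m => ?_) h4)
    obtain ⟨r, g, hr0, hr1, -, hg, hrg⟩ := hS m
    rw [hrg, add_sub_right_comm]
    refine (norm_add_le _ _).trans (add_le_add le_rfl ((norm_add_le _ _).trans
      (add_le_add ?_ (hg a))))
    rw [norm_smul, Complex.norm_real, Real.norm_of_nonneg hr0]
    exact mul_le_of_le_one_left (norm_nonneg _) hr1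
  · obtain ⟨r, g, hr0, hr1, hg, -, hrg⟩ := hS m
    refine (((hΘ _).add hm (((hΨ _).smul hm (r : ℂ)).add hm hg)).mono hm ?_).congr hrg
    have h5 : ‖(r : ℂ)‖ * (2 * |C|) ≤ 2 * |C| := by
      rw [Complex.norm_real, Real.norm_of_nonneg hr0]
      exact mul_le_of_le_one_left (by positivity) hr1
    have h6 : 1 / (((blockPos L m).1 : ℝ) + 1) ≤ 1 := by
      rw [div_le_one (by positivity)]; simp
    gcongr

/-- A separable C*-algebra `A` has the completely bounded approximation property if and only
if it has a cb-frame.  Here `mnorm n` denotes the (necessarily unique) C*-norm on the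
*-algebra `Mₙ(A)` of `n × n` matrices over `A`, characterized by the listed axioms; the
cb-norm conditions are expressed through these matrix norms. -/
theorem cbap_iff_exists_cbFrame
    {A : Type*} [NonUnitalCStarAlgebra A] [StarModule ℂ A]
    [TopologicalSpace.SeparableSpace A]
    (mnorm : ∀ n : ℕ, Matrix (Fin n) (Fin n) A → ℝ)
    (mnorm_add : ∀ n (x y : Matrix (Fin n) (Fin n) A),
      mnorm n (x + y) ≤ mnorm n x + mnorm n y)
    (mnorm_smul : ∀ n (c : ℂ) (x : Matrix (Fin n) (Fin n) A),
      mnorm n (c • x) = ‖c‖ * mnorm n x)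
    (mnorm_mul : ∀ n (x y : Matrix (Fin n) (Fin n) A),
      mnorm n (x * y) ≤ mnorm n x * mnorm n y)
    (mnorm_star_mul_self : ∀ n (x : Matrix (Fin n) (Fin n) A),
      mnorm n (star x * x) = mnorm n x ^ 2)
    (mnorm_pos : ∀ n (x : Matrix (Fin n) (Fin n) A), x ≠ 0 → 0 < mnorm n x)
    (mnorm_one : ∀ a : A, mnorm 1 (Matrix.of fun _ _ => a) = ‖a‖) :
    -- CBAP for `A`
    (∃ Φ : ℕ → A →L[ℂ] A,
      (∀ k, FiniteDimensional ℂ (LinearMap.range (Φ k : A →ₗ[ℂ] A))) ∧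
      (∃ C : ℝ, ∀ k (n : ℕ) (x : Matrix (Fin n) (Fin n) A),
        mnorm n (Matrix.of fun i j => Φ k (x i j)) ≤ C * mnorm n x) ∧
      (∀ a : A, Tendsto (fun k => Φ k a) atTop (nhds a))) ↔
    -- cb-frame for `A`
    (∃ (x : ℕ → A) (f : ℕ → (A →L[ℂ] ℂ)),
      (∀ a : A,
        Tendsto (fun N => ∑ t ∈ Finset.range N, f t a • x t) atTop (nhds a)) ∧
      (∃ C : ℝ, ∀ (m n : ℕ) (u : Matrix (Fin n) (Fin n) A),
        mnorm n (Matrix.of fun i j => ∑ t ∈ Finset.range m, f t (u i j) • x t) ≤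
          C * mnorm n u)) := by
  have hm : ∀ n, IsCStarNorm (mnorm n) := fun n =>
    ⟨mnorm_add n, mnorm_smul n, mnorm_mul n, mnorm_star_mul_self n, mnorm_pos n⟩
  constructor
  · rintro ⟨Φ, hΦfin, ⟨C, hC⟩, hΦ⟩
    exact exists_cbFrame_of_cbap hm Φ hΦfin (fun k => hC k) hΦ
  · rintro ⟨x, f, hconv, C, hC⟩
    refine ⟨fun k => ∑ t ∈ Finset.range k, (f t).smulRight (x t), fun k => ?_, ⟨C, fun k n u => ?_⟩,
      fun a => ?_⟩
    · have := FiniteDimensional.span_of_finite ℂ ((Finset.range k).finite_toSet.image x)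
      refine Submodule.finiteDimensional_of_le
        (S₂ := Submodule.span ℂ (x '' (Finset.range k : Set ℕ))) ?_
      rintro _ ⟨a, rfl⟩
      simp only [ContinuousLinearMap.coe_coe, _root_.sum_apply,
        ContinuousLinearMap.smulRight_apply]
      exact Submodule.sum_mem _ fun t ht =>
        Submodule.smul_mem _ _ (Submodule.subset_span ⟨t, ht, rfl⟩)
    · simpa using hC k n u
    · simpa using hconv a
end

section
/- Let X be a Banach space with a frame (x_i, f_i) such that ‖x_i‖ = 1 for every i. Then there exist a Banach space Y with a Schauder basis (e_i) of basis constant 1, and bounded linear maps T: X → Y and Q: Y → X, such that Q(e_i) = x_i for every i, ‖Q‖ ≤ 1, ‖T‖ ≤ sup_m ‖S_m‖, T(x) = ∑_{i=1}^∞ f_i(x) e_i for every x ∈ X, and Q ∘ T = id_X. In particular, T is an isomorphism of X onto the closed subspace T(X) of Y, and T∘Q is a bounded projection of Y onto T(X), so X is isomorphic to a complemented subspace of a Banach space with a monotone Schauder basis. -/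
open Filter

section CoefficientSpace

variable {X : Type*} [NormedAddCommGroup X] [NormedSpace ℂ X]

/-- The partial sum `α ↦ ∑ i < m, α i • x i` as a linear map on coefficient sequences. -/
def coeffPartialSum (x : ℕ → X) (m : ℕ) : (ℕ → ℂ) →ₗ[ℂ] X :=
  ∑ i ∈ Finset.range m, (LinearMap.proj i).smulRight (x i)

theorem coeffPartialSum_apply (x : ℕ → X) (m : ℕ) (α : ℕ → ℂ) :
    coeffPartialSum x m α = ∑ i ∈ Finset.range m, α i • x i := by
  simp [coeffPartialSum, LinearMap.sum_apply]

theorem coeffPartialSum_truncate (x : ℕ → X) (m N : ℕ) (α : ℕ → ℂ) :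
    coeffPartialSum x m (fun j => if j < N then α j else 0) =
      coeffPartialSum x (min m N) α := by
  simp only [coeffPartialSum_apply, ite_smul, zero_smul, ← Finset.sum_filter]
  congr 1
  ext j
  simp

/-- The coefficient sequences `α` for which `∑ α i • x i` converges. -/
def convergentCoeffs (x : ℕ → X) : Submodule ℂ (ℕ → ℂ) where
  carrier := {α | ∃ v, Tendsto (fun m => coeffPartialSum x m α) atTop (nhds v)}
  add_mem' := by
    rintro α β ⟨v, hv⟩ ⟨w, hw⟩
    exact ⟨v + w, by simpa using hv.add hw⟩
  zero_mem' := ⟨0, by simp⟩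
  smul_mem' := by
    rintro c α ⟨v, hv⟩
    exact ⟨c • v, by simpa using hv.const_smul c⟩

/-- The space of convergent coefficient sequences of a normalized sequence `x`, to be normed by
the supremum of the norms of the partial sums. -/
def CoeffSpace (x : ℕ → X) (_hx : ∀ i, ‖x i‖ = 1) : Type := convergentCoeffs x

namespace CoeffSpace

variable {x : ℕ → X} {hx : ∀ i, ‖x i‖ = 1}

instance : AddCommGroup (CoeffSpace x hx) := inferInstanceAs (AddCommGroup (convergentCoeffs x))

instance : Module ℂ (CoeffSpace x hx) := inferInstanceAs (Module ℂ (convergentCoeffs x))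

/-- The coefficient sequence of an element of `CoeffSpace`. -/
def coeff : CoeffSpace x hx →ₗ[ℂ] (ℕ → ℂ) := (convergentCoeffs x).subtype

theorem coeff_injective : Function.Injective (coeff : CoeffSpace x hx →ₗ[ℂ] (ℕ → ℂ)) :=
  Subtype.val_injective

/-- The element of `CoeffSpace` with given coefficients. -/
def ofCoeff (hx : ∀ i, ‖x i‖ = 1) (α : ℕ → ℂ)
    (hα : ∃ v, Tendsto (fun m => coeffPartialSum x m α) atTop (nhds v)) : CoeffSpace x hx :=
  ⟨α, hα⟩

@[simp]
theorem coeff_ofCoeff (α : ℕ → ℂ)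
    (hα : ∃ v, Tendsto (fun m => coeffPartialSum x m α) atTop (nhds v)) :
    coeff (ofCoeff hx α hα) = α := rfl

theorem exists_tendsto (y : CoeffSpace x hx) :
    ∃ v, Tendsto (fun m => coeffPartialSum x m (coeff y)) atTop (nhds v) := y.2

theorem exists_norm_le (y : CoeffSpace x hx) : ∃ C, ∀ m, ‖coeffPartialSum x m (coeff y)‖ ≤ C := by
  obtain ⟨v, hv⟩ := y.exists_tendsto
  obtain ⟨C, hC⟩ := (Metric.isBounded_range_of_tendsto _ hv).exists_norm_le
  exact ⟨C, fun m => hC _ ⟨m, rfl⟩⟩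

/-- The bounded sequence of partial sums of an element of `CoeffSpace`. -/
noncomputable def sums : CoeffSpace x hx →ₗ[ℂ] BoundedContinuousFunction ℕ X where
  toFun y := BoundedContinuousFunction.ofNormedAddCommGroupDiscrete
    (fun m => coeffPartialSum x m (coeff y)) y.exists_norm_le.choose y.exists_norm_le.choose_spec
  map_add' y z := by ext m; simp
  map_smul' c y := by ext m; simp

@[simp]
theorem sums_apply (y : CoeffSpace x hx) (m : ℕ) :
    sums y m = coeffPartialSum x m (coeff y) := rfl

theorem norm_coeff_le_sums (y : CoeffSpace x hx) (i : ℕ) : ‖coeff y i‖ ≤ 2 * ‖sums y‖ := by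
  have h : coeff y i • x i = sums y (i + 1) - sums y i := by
    simp [coeffPartialSum_apply, Finset.sum_range_succ]
  calc ‖coeff y i‖ = ‖coeff y i • x i‖ := by rw [norm_smul, hx, mul_one]
    _ ≤ ‖sums y (i + 1)‖ + ‖sums y i‖ := h ▸ norm_sub_le _ _
    _ ≤ 2 * ‖sums y‖ := by
      linarith [(sums y).norm_coe_le_norm (i + 1), (sums y).norm_coe_le_norm i]

theorem sums_injective :
    Function.Injective (sums : CoeffSpace x hx →ₗ[ℂ] BoundedContinuousFunction ℕ X) := by
  rw [← LinearMap.ker_eq_bot, LinearMap.ker_eq_bot']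
  intro y hy
  apply coeff_injective
  ext i
  simpa [hy] using y.norm_coeff_le_sums i

noncomputable instance : NormedAddCommGroup (CoeffSpace x hx) :=
  NormedAddCommGroup.induced _ _ sums sums_injective

theorem norm_def (y : CoeffSpace x hx) : ‖y‖ = ‖sums y‖ := rfl

noncomputable instance : NormedSpace ℂ (CoeffSpace x hx) where
  norm_smul_le c y := by rw [norm_def, map_smul, norm_smul, norm_def]

theorem norm_partialSum_le (y : CoeffSpace x hx) (m : ℕ) :
    ‖coeffPartialSum x m (coeff y)‖ ≤ ‖y‖ := (sums y).norm_coe_le_norm m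

theorem norm_le {y : CoeffSpace x hx} {C : ℝ} :
    ‖y‖ ≤ C ↔ ∀ m, ‖coeffPartialSum x m (coeff y)‖ ≤ C := by
  rw [norm_def, BoundedContinuousFunction.norm_le_of_nonempty]
  rfl

theorem norm_coeff_le (y : CoeffSpace x hx) (i : ℕ) : ‖coeff y i‖ ≤ 2 * ‖y‖ :=
  y.norm_coeff_le_sums i

theorem uniformContinuous_coeff (i : ℕ) :
    UniformContinuous fun y : CoeffSpace x hx => coeff y i :=
  (((LinearMap.proj i).comp coeff).mkContinuous 2 fun y => y.norm_coeff_le i).uniformContinuous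

theorem isometry_sums :
    Isometry (sums : CoeffSpace x hx →ₗ[ℂ] BoundedContinuousFunction ℕ X) :=
  AddMonoidHomClass.isometry_of_norm _ fun _ => rfl

instance [CompleteSpace X] : CompleteSpace (CoeffSpace x hx) := by
  refine Metric.complete_of_cauchySeq_tendsto fun u hu => ?_
  obtain ⟨g, hg⟩ := cauchySeq_tendsto_of_complete
    (isometry_sums.uniformContinuous.comp_cauchySeq hu)
  have hcoeff : ∀ i, ∃ a, Tendsto (fun n => coeff (u n) i) atTop (nhds a) := fun i =>
    cauchySeq_tendsto_of_complete ((uniformContinuous_coeff i).comp_cauchySeq hu)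
  choose α hα using hcoeff
  have hgm : ∀ m, g m = coeffPartialSum x m α := fun m => by
    refine tendsto_nhds_unique
      (((BoundedContinuousFunction.lipschitz_eval_const m).continuous.tendsto g).comp hg) ?_
    simp only [Function.comp_def, sums_apply, coeffPartialSum_apply]
    exact tendsto_finsetSum _ fun i _ => (hα i).smul_const _
  have hcauchy : CauchySeq g := by
    rw [Metric.cauchySeq_iff']
    intro ε hε
    obtain ⟨n, hn⟩ := Metric.tendsto_atTop.1 hg (ε / 3) (by positivity)
    have hn := hn n le_rfl
    obtain ⟨v, hv⟩ := (u n).exists_tendsto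
    obtain ⟨N, hN⟩ := Metric.cauchySeq_iff'.1 hv.cauchySeq (ε / 3) (by positivity)
    refine ⟨N, fun m hm => ?_⟩
    have h₁ := (BoundedContinuousFunction.dist_coe_le_dist m).trans_lt hn
    have h₂ := (BoundedContinuousFunction.dist_coe_le_dist N).trans_lt hn
    have h₃ := hN m hm
    rw [dist_comm] at h₁
    have h₄ := dist_triangle4 (g m) (sums (u n) m) (sums (u n) N) (g N)
    simp only [Function.comp_def, sums_apply] at h₁ h₂ h₄
    linarith
  obtain ⟨v, hv⟩ := cauchySeq_tendsto_of_complete hcauchy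
  refine ⟨ofCoeff hx α ⟨v, by simpa only [← hgm] using hv⟩, ?_⟩
  rw [isometry_sums.isEmbedding.tendsto_nhds_iff]
  convert hg
  ext m
  simp [hgm]

/-- The unit vectors of `CoeffSpace`. -/
noncomputable def unitVec (hx : ∀ i, ‖x i‖ = 1) (i : ℕ) : CoeffSpace x hx :=
  ofCoeff hx (Pi.single i 1) ⟨x i, tendsto_const_nhds.congr' <| by
    filter_upwards [eventually_gt_atTop i] with m hm
    simp [coeffPartialSum_apply, Pi.single_apply, hm]⟩

theorem coeff_sum_unitVec (α : ℕ → ℂ) (N : ℕ) :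
    coeff (∑ i ∈ Finset.range N, α i • unitVec hx i) = fun j => if j < N then α j else 0 := by
  ext j
  simp [unitVec, Pi.single_apply]

theorem norm_sum_unitVec_mono (α : ℕ → ℂ) {M N : ℕ} (h : M ≤ N) :
    ‖∑ i ∈ Finset.range M, α i • unitVec hx i‖ ≤ ‖∑ i ∈ Finset.range N, α i • unitVec hx i‖ := by
  refine norm_le.2 fun m => ?_
  have := norm_partialSum_le (∑ i ∈ Finset.range N, α i • unitVec hx i) (min m M)
  rw [coeff_sum_unitVec, coeffPartialSum_truncate] at this ⊢
  rwa [min_eq_left (min_le_of_right_le h)] at this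

theorem tendsto_sum_coeff_unitVec (y : CoeffSpace x hx) :
    Tendsto (fun N => ∑ i ∈ Finset.range N, coeff y i • unitVec hx i) atTop (nhds y) := by
  rw [Metric.tendsto_atTop]
  intro ε hε
  obtain ⟨v, hv⟩ := y.exists_tendsto
  obtain ⟨N, hN⟩ := Metric.cauchySeq_iff.1 hv.cauchySeq (ε / 2) (by positivity)
  refine ⟨N, fun n hn => ?_⟩
  rw [dist_eq_norm]
  refine lt_of_le_of_lt (norm_le.2 fun m => ?_) (half_lt_self hε)
  rw [map_sub, map_sub, coeff_sum_unitVec, coeffPartialSum_truncate, ← dist_eq_norm]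
  rcases le_total m n with h | h
  · simpa [min_eq_left h] using (half_pos hε).le
  · rw [min_eq_right h]
    exact (hN n hn m (hn.trans h)).le

theorem eq_coeff_of_tendsto {y : CoeffSpace x hx} {α : ℕ → ℂ}
    (h : Tendsto (fun N => ∑ i ∈ Finset.range N, α i • unitVec hx i) atTop (nhds y)) :
    α = coeff y := by
  ext j
  refine tendsto_nhds_unique (tendsto_const_nhds.congr' ?_)
    (((uniformContinuous_coeff j).continuous.tendsto y).comp h)
  filter_upwards [eventually_gt_atTop j] with N hN
  simp only [Function.comp_def, coeff_sum_unitVec, if_pos hN]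

/-- The sum `∑ α i • x i` of an element `α` of `CoeffSpace`. -/
noncomputable def total (hx : ∀ i, ‖x i‖ = 1) : CoeffSpace x hx →L[ℂ] X :=
  LinearMap.mkContinuous
    { toFun := fun y => y.exists_tendsto.choose
      map_add' := fun y z => tendsto_nhds_unique (y + z).exists_tendsto.choose_spec <| by
        simpa using y.exists_tendsto.choose_spec.add z.exists_tendsto.choose_spec
      map_smul' := fun c y => tendsto_nhds_unique (c • y).exists_tendsto.choose_spec <| by
        simpa using y.exists_tendsto.choose_spec.const_smul c } 1 fun y => by
    rw [one_mul]
    exact le_of_tendsto y.exists_tendsto.choose_spec.norm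
      (Eventually.of_forall y.norm_partialSum_le)

theorem tendsto_total (y : CoeffSpace x hx) :
    Tendsto (fun m => coeffPartialSum x m (coeff y)) atTop (nhds (total hx y)) :=
  y.exists_tendsto.choose_spec

theorem norm_total_le : ‖total hx‖ ≤ 1 := LinearMap.mkContinuous_norm_le _ zero_le_one _

theorem total_unitVec (i : ℕ) : total hx (unitVec hx i) = x i := by
  refine tendsto_nhds_unique (tendsto_total _) (tendsto_const_nhds.congr' ?_)
  filter_upwards [eventually_gt_atTop i] with m hm
  simp [unitVec, coeffPartialSum_apply, Pi.single_apply, hm]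

end CoeffSpace

/-- The partial sum operators of a frame of a Banach space are uniformly bounded. -/
theorem bddAbove_norm_frame_sums [CompleteSpace X] {x : ℕ → X} {f : ℕ → (X →L[ℂ] ℂ)}
    (hframe : ∀ v : X,
      Tendsto (fun N => ∑ i ∈ Finset.range N, f i v • x i) atTop (nhds v)) :
    BddAbove (Set.range fun m : ℕ => ‖∑ i ∈ Finset.range m, (f i).smulRight (x i)‖) := by
  obtain ⟨C, hC⟩ := banach_steinhaus
    (g := fun m : ℕ => ∑ i ∈ Finset.range m, (f i).smulRight (x i)) fun v => by
      obtain ⟨C, hC⟩ := (Metric.isBounded_range_of_tendsto _ (hframe v)).exists_norm_le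
      exact ⟨C, fun m => by simpa using hC _ ⟨m, rfl⟩⟩
  exact ⟨C, by rintro _ ⟨m, rfl⟩; exact hC m⟩

end CoefficientSpace

/-- A Banach space with a frame `(x_i, f_i)` (with `‖x_i‖ = 1`) embeds, via maps `T`, `Q` with
`Q ∘ T = id`, as a complemented subspace of a Banach space `Y` with a monotone Schauder basis
`(e_i)` satisfying `Q(e_i) = x_i`, `‖Q‖ ≤ 1`, `‖T‖ ≤ sup_m ‖S_m‖`, and
`T(x) = ∑ᵢ f_i(x) e_i`. -/
theorem frame_dilates_to_monotone_basis
    {X : Type*} [NormedAddCommGroup X] [NormedSpace ℂ X] [CompleteSpace X]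
    (x : ℕ → X) (f : ℕ → (X →L[ℂ] ℂ))
    (hx : ∀ i, ‖x i‖ = 1)
    (hframe : ∀ v : X,
      Tendsto (fun N => ∑ i ∈ Finset.range N, f i v • x i) atTop (nhds v)) :
    ∃ (Y : Type) (_ : NormedAddCommGroup Y) (_ : NormedSpace ℂ Y) (_ : CompleteSpace Y)
      (e : ℕ → Y) (T : X →L[ℂ] Y) (Q : Y →L[ℂ] X),
      -- `(e_i)` is a Schauder basis of `Y`
      (∀ y : Y, ∃! α : ℕ → ℂ,
        Tendsto (fun N => ∑ i ∈ Finset.range N, α i • e i) atTop (nhds y)) ∧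
      -- with basis constant `1` (monotone basis)
      (∀ (α : ℕ → ℂ) (M N : ℕ), M ≤ N →
        ‖∑ i ∈ Finset.range M, α i • e i‖ ≤ ‖∑ i ∈ Finset.range N, α i • e i‖) ∧
      (∀ i, Q (e i) = x i) ∧
      ‖Q‖ ≤ 1 ∧
      ‖T‖ ≤ (⨆ m : ℕ, ‖∑ i ∈ Finset.range m, (f i).smulRight (x i)‖) ∧
      (∀ v : X,
        Tendsto (fun N => ∑ i ∈ Finset.range N, f i v • e i) atTop (nhds (T v))) ∧
      Q.comp T = ContinuousLinearMap.id ℂ X := by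
  have hsum : ∀ v m, coeffPartialSum x m (fun i => f i v) =
      (∑ i ∈ Finset.range m, (f i).smulRight (x i)) v := fun v m => by
    simp [coeffPartialSum_apply]
  have hlim : ∀ v, Tendsto (fun m => coeffPartialSum x m (fun i => f i v)) atTop (nhds v) :=
    fun v => by simpa only [coeffPartialSum_apply] using hframe v
  have hbdd := bddAbove_norm_frame_sums hframe
  let T : X →L[ℂ] CoeffSpace x hx := LinearMap.mkContinuous
    { toFun := fun v => CoeffSpace.ofCoeff hx (fun i => f i v) ⟨v, hlim v⟩
      map_add' := fun v w => CoeffSpace.coeff_injective <| by ext i; simp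
      map_smul' := fun c v => CoeffSpace.coeff_injective <| by ext i; simp }
    (⨆ m : ℕ, ‖∑ i ∈ Finset.range m, (f i).smulRight (x i)‖) fun v =>
      CoeffSpace.norm_le.2 fun m => by
        simp only [LinearMap.coe_mk, AddHom.coe_mk, CoeffSpace.coeff_ofCoeff, hsum]
        exact (ContinuousLinearMap.le_opNorm _ v).trans
          (mul_le_mul_of_nonneg_right (le_ciSup hbdd m) (norm_nonneg v))
  have hT : ∀ v, CoeffSpace.coeff (T v) = fun i => f i v := fun v => rfl
  refine ⟨CoeffSpace x hx, inferInstance, inferInstance, inferInstance, CoeffSpace.unitVec hx, T,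
    CoeffSpace.total hx, fun y => ⟨CoeffSpace.coeff y, y.tendsto_sum_coeff_unitVec,
      fun α => CoeffSpace.eq_coeff_of_tendsto⟩, fun α M N => CoeffSpace.norm_sum_unitVec_mono α,
    CoeffSpace.total_unitVec, CoeffSpace.norm_total_le,
    LinearMap.mkContinuous_norm_le _ (Real.iSup_nonneg fun m => norm_nonneg _) _,
    fun v => (T v).tendsto_sum_coeff_unitVec, ?_⟩
  ext v
  exact tendsto_nhds_unique (T v).tendsto_total (hlim v)
end

section
/- Let X be a Banach space with an unconditional frame (x_i, f_i) such that ‖x_i‖ = 1 for every i; that is, for every x ∈ X and every permutation σ of ℕ, the series ∑_{n=1}^∞ f_{σ(n)}(x) x_{σ(n)} converges in norm to x. Then there exist a Banach space Y with a 1-unconditional Schauder basis (e_i), and bounded linear maps T: X → Y and Q: Y → X, such that Q(e_i) = x_i for every i and Q ∘ T = id_X. In particular, X is isomorphic to a complemented subspace of a Banach space with a 1-unconditional basis. -/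
open Filter

/-- Nested finite lists without repetition that exhaust `ℕ` are initial segments of the
enumeration given by a single permutation. -/
theorem exists_perm_of_nested_lists (A : ℕ → List ℕ) (hpre : ∀ k, A k <+: A (k + 1))
    (hnodup : ∀ k, (A k).Nodup) (hmem : ∀ k, k ∈ A (k + 1)) :
    ∃ σ : Equiv.Perm ℕ, ∀ (k : ℕ) (l : List ℕ), l <+: A k → (List.range l.length).map σ = l := by
  have hmono : ∀ {j k}, j ≤ k → A j <+: A k := fun {j k} h => by
    induction h with
    | refl => exact List.prefix_rfl
    | step _ ih => exact ih.trans (hpre _)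
  have hlen : ∀ k, k < (A (k + 1)).length := fun k => by
    have hsub : Finset.range (k + 1) ⊆ (A (k + 1)).toFinset := fun i hi =>
      List.mem_toFinset.2 ((hmono (by simpa using hi)).subset (hmem i))
    have := Finset.card_le_card hsub
    rw [Finset.card_range, List.toFinset_card_of_nodup (hnodup _)] at this
    exact this
  let s : ℕ → ℕ := fun n => (A (n + 1))[n]'(hlen n)
  have hs : ∀ k n (h : n < (A k).length), s n = (A k)[n] := fun k n h => by
    rcases le_total (n + 1) k with hk | hk
    · exact (hmono hk).getElem (hlen n)
    · exact ((hmono hk).getElem h).symm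
  have hinj : Function.Injective s := fun m n hmn => by
    have hm := (hmono (show m + 1 ≤ max m n + 1 by omega)).length_le
    have hn := (hmono (show n + 1 ≤ max m n + 1 by omega)).length_le
    rw [hs (max m n + 1) m ((hlen m).trans_le hm), hs (max m n + 1) n ((hlen n).trans_le hn)] at hmn
    exact (List.Nodup.getElem_inj_iff (hnodup _)).1 hmn
  have hsurj : Function.Surjective s := fun k => by
    obtain ⟨n, hn, h⟩ := List.getElem_of_mem (hmem k)
    exact ⟨n, (hs _ n hn).trans h⟩
  refine ⟨Equiv.ofBijective s ⟨hinj, hsurj⟩, fun k l hl => List.ext_getElem (by simp) ?_⟩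
  intro n _ h
  simp only [List.getElem_map, List.getElem_range]
  exact (hs k n (h.trans_le hl.length_le)).trans (hl.getElem h).symm

/-- In a Banach space, a series all of whose rearrangements have Cauchy partial sums is summable. -/
theorem summable_of_forall_perm_cauchySeq {X : Type*} [NormedAddCommGroup X] [CompleteSpace X]
    {g : ℕ → X}
    (h : ∀ σ : Equiv.Perm ℕ, CauchySeq fun N => ∑ n ∈ Finset.range N, g (σ n)) :
    Summable g := by
  rw [summable_iff_vanishing_norm]
  by_contra! hcon
  obtain ⟨ε, hε, hcon⟩ := hcon
  choose t hdisj ht using hcon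
  let B : List ℕ → List ℕ := fun l => l ++ (t l.toFinset).toList
  let A : ℕ → List ℕ := fun k =>
    Nat.rec [] (fun k l => if k ∈ B l then B l else B l ++ [k]) k
  have hA : ∀ k, A (k + 1) = if k ∈ B (A k) then B (A k) else B (A k) ++ [k] := fun k => rfl
  have hB : ∀ k, B (A k) <+: A (k + 1) := fun k => by
    rw [hA]
    split_ifs
    · exact List.prefix_rfl
    · exact List.prefix_append _ _
  have hAB : ∀ l, l <+: B l := fun l => List.prefix_append _ _
  have hBnodup : ∀ l : List ℕ, l.Nodup → (B l).Nodup := fun l hl =>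
    hl.append (Finset.nodup_toList _) fun i hi hi' =>
      Finset.disjoint_left.1 (hdisj l.toFinset) (Finset.mem_toList.1 hi') (List.mem_toFinset.2 hi)
  have hnodup : ∀ k, (A k).Nodup := fun k => by
    induction k with
    | zero => exact List.nodup_nil
    | succ k ih =>
      rw [hA]
      split_ifs with hk
      · exact hBnodup _ ih
      · exact (hBnodup _ ih).append (List.nodup_singleton k) (by simpa using hk)
  obtain ⟨σ, hσ⟩ := exists_perm_of_nested_lists A (fun k => (hAB _).trans (hB k)) hnodup fun k => by
    rw [hA]
    split_ifs with hk
    · exact hk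
    · simp
  have hsum : ∀ k l, l <+: A k → ∑ n ∈ Finset.range l.length, g (σ n) = (l.map g).sum :=
    fun k l hl => by
      conv_rhs => rw [← hσ k l hl, List.map_map]
      rfl
  obtain ⟨N, hN⟩ := Metric.cauchySeq_iff.1 (h σ) ε hε
  have hlen : N ≤ (A N).length := by
    have hgrow : ∀ k, k ≤ (A k).length := fun k => by
      induction k with
      | zero => exact Nat.zero_le _
      | succ k ih =>
        refine ih.trans_lt (lt_of_lt_of_le ?_ (hB k).length_le)
        have hne : (t (A k).toFinset).Nonempty := by
          by_contra hemp
          have := ht (A k).toFinset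
          rw [Finset.not_nonempty_iff_eq_empty.1 hemp] at this
          simp at this
          linarith
        simpa [B] using hne.card_pos
    exact hgrow N
  have hlt := hN (B (A N)).length (hlen.trans (hAB _).length_le) (A N).length hlen
  rw [hsum (N + 1) _ (hB N), hsum N _ List.prefix_rfl, dist_eq_norm] at hlt
  refine (ht (A N).toFinset).not_gt ?_
  simpa [B] using hlt

/-- The closed span of a linearly independent sequence is isometric to a Banach space living in
the lowest universe. -/
theorem exists_small_isometric_closedSpan {Z : Type*} [NormedAddCommGroup Z] [NormedSpace ℂ Z]
    [CompleteSpace Z] {z : ℕ → Z} (hz : LinearIndependent ℂ z) :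
    ∃ (Y : Type) (_ : NormedAddCommGroup Y) (_ : NormedSpace ℂ Y) (_ : CompleteSpace Y)
      (e : ℕ → Y) (J : Y →L[ℂ] Z), (∀ y, ‖J y‖ = ‖y‖) ∧ (∀ i, J (e i) = z i) ∧
      Dense (Submodule.span ℂ (Set.range e) : Set Y) := by
  let L : (ℕ →₀ ℂ) →ₗ[ℂ] Z := Finsupp.linearCombination ℂ z
  let _ : NormedAddCommGroup (ℕ →₀ ℂ) := NormedAddCommGroup.induced _ Z L hz
  let _ : NormedSpace ℂ (ℕ →₀ ℂ) := NormedSpace.induced ℂ (ℕ →₀ ℂ) Z L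
  let ι : (ℕ →₀ ℂ) →L[ℂ] UniformSpace.Completion (ℕ →₀ ℂ) := UniformSpace.Completion.toComplL
  let L' : (ℕ →₀ ℂ) →L[ℂ] Z := L.mkContinuous 1 fun a => (one_mul ‖a‖).ge
  have hdense : DenseRange ι := UniformSpace.Completion.denseRange_coe
  have hind : IsUniformInducing ι := UniformSpace.Completion.isUniformInducing_coe _
  have hJ : ∀ a, L'.extend ι (ι a) = L a := fun a => L'.extend_eq hdense hind a
  refine ⟨UniformSpace.Completion (ℕ →₀ ℂ), inferInstance, inferInstance, inferInstance,
    fun i => ι (Finsupp.single i 1), L'.extend ι, fun y => ?_, fun i => ?_, ?_⟩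
  · refine hdense.induction_on y (isClosed_eq (by fun_prop) (by fun_prop)) fun a => ?_
    rw [hJ]
    exact (UniformSpace.Completion.norm_coe a).symm
  · rw [hJ]
    simp [L]
  · refine hdense.mono ?_
    rintro _ ⟨a, rfl⟩
    rw [← Finsupp.sum_single a, Finsupp.sum, map_sum]
    refine Submodule.sum_mem _ fun i _ => ?_
    rw [← mul_one (a i), ← smul_eq_mul, ← Finsupp.smul_single, map_smul]
    exact Submodule.smul_mem _ _ (Submodule.subset_span ⟨i, rfl⟩)

/-- A biorthogonal system with dense span whose partial sum operators are contractions is a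
Schauder basis. -/
theorem existsUnique_expansion_of_biorthogonal {Y : Type*} [NormedAddCommGroup Y]
    [NormedSpace ℂ Y] {e : ℕ → Y} {c : ℕ → Y →L[ℂ] ℂ}
    (hce : ∀ i j, c i (e j) = if i = j then 1 else 0)
    (hdense : Dense (Submodule.span ℂ (Set.range e) : Set Y))
    (hbound : ∀ N y, ‖∑ i ∈ Finset.range N, c i y • e i‖ ≤ ‖y‖) (y : Y) :
    ∃! α : ℕ → ℂ, Tendsto (fun N => ∑ i ∈ Finset.range N, α i • e i) atTop (nhds y) := by
  have hspan : ∀ u ∈ Submodule.span ℂ (Set.range e),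
      ∀ᶠ N in atTop, ∑ i ∈ Finset.range N, c i u • e i = u := fun u hu => by
    induction hu using Submodule.span_induction with
    | mem u hu =>
      obtain ⟨j, rfl⟩ := hu
      filter_upwards [eventually_gt_atTop j] with N hN
      simp [hce, hN]
    | zero => simp
    | add u v _ _ hu hv =>
      filter_upwards [hu, hv] with N hu hv
      simp [add_smul, Finset.sum_add_distrib, hu, hv]
    | smul a u _ hu =>
      filter_upwards [hu] with N hu
      simp [mul_smul, ← Finset.smul_sum, hu]
  refine ⟨fun i => c i y, ?_, fun α hα => funext fun j => ?_⟩
  · refine Metric.tendsto_nhds.2 fun ε hε => ?_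
    obtain ⟨u, hu, hyu⟩ := Metric.dense_iff.1 hdense y (ε / 2) (half_pos hε)
    rw [Metric.mem_ball, dist_eq_norm, norm_sub_rev] at hu
    filter_upwards [hspan u hyu] with N hN
    have hsub : ∑ i ∈ Finset.range N, c i y • e i - y =
        ∑ i ∈ Finset.range N, c i (y - u) • e i - (y - u) := by
      simp only [map_sub, sub_smul, Finset.sum_sub_distrib, hN]
      abel
    rw [dist_eq_norm, hsub]
    linarith [norm_sub_le (∑ i ∈ Finset.range N, c i (y - u) • e i) (y - u), hbound N (y - u)]
  · refine tendsto_nhds_unique (Tendsto.congr' ?_ tendsto_const_nhds)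
      (((c j).continuous.tendsto y).comp hα)
    filter_upwards [eventually_gt_atTop j] with N hN
    simp [hce, hN]

/-- The sequence in `ℓ^∞(Set ℕ, X)` whose `i`-th term sends `S` to `x i` if `i ∈ S` and to `0`
otherwise. The norm of a linear combination of its terms is the supremum of the norms of all
subsums of the corresponding combination of the `x i`. -/
noncomputable def subsumSequence {X : Type*} [NormedAddCommGroup X] (x : ℕ → X) (i : ℕ) :
    lp (fun _ : Set ℕ => X) ⊤ :=
  ⟨fun S => S.indicator x i, memℓp_infty ⟨‖x i‖, by
    rintro _ ⟨S, rfl⟩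
    exact norm_indicator_le_norm_self x i⟩⟩

theorem subsumSequence_apply {X : Type*} [NormedAddCommGroup X] (x : ℕ → X) (i : ℕ) (S : Set ℕ) :
    subsumSequence x i S = S.indicator x i := rfl

section SubsumSequence

variable {X : Type*} [NormedAddCommGroup X] [NormedSpace ℂ X] (x : ℕ → X)

open scoped Classical in
theorem sum_smul_subsumSequence_apply (α : ℕ → ℂ) (E : Finset ℕ) (S : Set ℕ) :
    (∑ i ∈ E, α i • subsumSequence x i) S = ∑ i ∈ E with i ∈ S, α i • x i := by
  rw [lp.coeFn_sum, Finset.sum_apply, Finset.sum_filter]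
  refine Finset.sum_congr rfl fun i _ => ?_
  rw [lp.coeFn_smul, Pi.smul_apply, subsumSequence_apply, Set.indicator_apply, smul_ite, smul_zero]

theorem norm_sum_smul_subsumSequence_mono (α : ℕ → ℂ) {E F : Finset ℕ} (hEF : E ⊆ F) :
    ‖∑ i ∈ E, α i • subsumSequence x i‖ ≤ ‖∑ i ∈ F, α i • subsumSequence x i‖ := by
  classical
  refine lp.norm_le_of_forall_le (norm_nonneg _) fun S => ?_
  refine le_trans (le_of_eq ?_) (lp.norm_apply_le_norm ENNReal.top_ne_zero _ (S ∩ E))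
  rw [sum_smul_subsumSequence_apply, sum_smul_subsumSequence_apply]
  congr 2
  ext i
  simp only [Finset.mem_filter, Set.mem_inter_iff, Finset.mem_coe]
  have := @hEF i
  tauto

theorem summable_smul_subsumSequence [CompleteSpace X] {α : ℕ → ℂ}
    (h : Summable fun i => α i • x i) : Summable fun i => α i • subsumSequence x i := by
  classical
  rw [summable_iff_vanishing_norm] at h ⊢
  intro ε hε
  obtain ⟨s, hs⟩ := h (ε / 2) (half_pos hε)
  refine ⟨s, fun t ht => lt_of_le_of_lt ?_ (half_lt_self hε)⟩
  refine lp.norm_le_of_forall_le (half_pos hε).le fun S => ?_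
  rw [sum_smul_subsumSequence_apply]
  exact (hs _ (ht.mono_left (Finset.filter_subset _ _))).le

end SubsumSequence

/-- A Banach space with an unconditional frame `(x_i, f_i)` (with `‖x_i‖ = 1`) embeds, via
maps `T`, `Q` with `Q ∘ T = id` and `Q(e_i) = x_i`, as a complemented subspace of a Banach
space `Y` with a `1`-unconditional Schauder basis `(e_i)`. -/
theorem unconditional_frame_dilates_to_unconditional_basis
    {X : Type*} [NormedAddCommGroup X] [NormedSpace ℂ X] [CompleteSpace X]
    (x : ℕ → X) (f : ℕ → (X →L[ℂ] ℂ))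
    (hx : ∀ i, ‖x i‖ = 1)
    (hframe : ∀ (v : X) (σ : Equiv.Perm ℕ),
      Tendsto (fun N => ∑ n ∈ Finset.range N, f (σ n) v • x (σ n)) atTop (nhds v)) :
    ∃ (Y : Type) (_ : NormedAddCommGroup Y) (_ : NormedSpace ℂ Y) (_ : CompleteSpace Y)
      (e : ℕ → Y) (T : X →L[ℂ] Y) (Q : Y →L[ℂ] X),
      -- `(e_i)` is a Schauder basis of `Y`
      (∀ y : Y, ∃! α : ℕ → ℂ,
        Tendsto (fun N => ∑ i ∈ Finset.range N, α i • e i) atTop (nhds y)) ∧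
      -- which is `1`-unconditional: every coordinate projection has norm at most 1
      (∀ (α : ℕ → ℂ) (E F : Finset ℕ), E ⊆ F →
        ‖∑ i ∈ E, α i • e i‖ ≤ ‖∑ i ∈ F, α i • e i‖) ∧
      (∀ i, Q (e i) = x i) ∧
      Q.comp T = ContinuousLinearMap.id ℂ X := by
  classical
  have hφ : ∀ i, ∃ φ : X →L[ℂ] ℂ, φ (x i) = 1 := fun i => by
    obtain ⟨φ, -, hφ⟩ := exists_dual_vector ℂ (x i) (fun h => by simpa [h] using hx i)
    exact ⟨φ, by simp [hφ, hx]⟩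
  choose φ hφ using hφ
  let Z := lp (fun _ : Set ℕ => X) ⊤
  let ev : Set ℕ → Z →L[ℂ] X := fun S => lp.evalCLM ℂ _ ⊤ S
  have hev : ∀ S (w : Z), ev S w = w S := fun _ _ => rfl
  have hcz : ∀ i j, φ i (ev {i} (subsumSequence x j)) = if i = j then 1 else 0 := fun i j => by
    rw [hev, subsumSequence_apply, Set.indicator_apply]
    rcases eq_or_ne i j with rfl | hij
    · simp [hφ]
    · simp [hij, hij.symm]
  have hz : LinearIndependent ℂ (subsumSequence x) := by
    refine linearIndependent_iff'.2 fun s a ha i hi => ?_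
    have := congrArg (fun w => φ i (ev {i} w)) ha
    simpa [map_sum, hcz, hi] using this
  obtain ⟨Y, _, _, _, e, J, hJ, hJe, hdense⟩ := exists_small_isometric_closedSpan hz
  let c : ℕ → Y →L[ℂ] ℂ := fun i => (φ i).comp ((ev {i}).comp J)
  have hc : ∀ i y, c i y = φ i (ev {i} (J y)) := fun _ _ => rfl
  have hce : ∀ i j, c i (e j) = if i = j then 1 else 0 := fun i j => by rw [hc, hJe, hcz]
  have hJsum : ∀ (α : ℕ → ℂ) (E : Finset ℕ),
      J (∑ i ∈ E, α i • e i) = ∑ i ∈ E, α i • subsumSequence x i := fun α E => by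
    simp [map_sum, hJe]
  have hproj : ∀ N S y, ev S (J (∑ i ∈ Finset.range N, c i y • e i)) =
      ev (S ∩ Finset.range N) (J y) := fun N S => by
    have : (ev S).comp (J.comp (∑ i ∈ Finset.range N, (c i).smulRight (e i))) =
        (ev (S ∩ Finset.range N)).comp J := by
      refine ContinuousLinearMap.ext_on hdense ?_
      rintro _ ⟨j, rfl⟩
      simp only [ContinuousLinearMap.comp_apply, sum_apply,
        ContinuousLinearMap.smulRight_apply, hJe, hev, hce, ite_smul, one_smul, zero_smul]
      by_cases hj : j < N <;> simp [hj, hJe, subsumSequence_apply, Set.indicator_apply]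
    intro y
    simpa using DFunLike.congr_fun this y
  have hbound : ∀ N y, ‖∑ i ∈ Finset.range N, c i y • e i‖ ≤ ‖y‖ := fun N y => by
    rw [← hJ, ← hJ y]
    refine lp.norm_le_of_forall_le (norm_nonneg _) fun S => ?_
    rw [← hev, hproj, hev]
    exact lp.norm_apply_le_norm ENNReal.top_ne_zero (J y) (S ∩ Finset.range N)
  have hsummable : ∀ v, Summable fun i => f i v • e i := fun v => by
    have hX : Summable fun i => f i v • x i :=
      summable_of_forall_perm_cauchySeq fun σ => (hframe v σ).cauchySeq
    have hZ := summable_smul_subsumSequence x hX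
    rw [summable_iff_vanishing_norm] at hZ ⊢
    simpa only [← hJ, hJsum] using hZ
  let Tpart : ℕ → X →L[ℂ] Y := fun N => ∑ i ∈ Finset.range N, (f i).smulRight (e i)
  have hTpart : Tendsto (fun N v => Tpart N v) atTop (nhds fun v => ∑' i, f i v • e i) := by
    refine tendsto_pi_nhds.2 fun v => ?_
    simpa [Tpart] using (hsummable v).hasSum.tendsto_sum_nat
  have hQe : ∀ i, ev Set.univ (J (e i)) = x i := fun i => by
    simp [hJe, hev, subsumSequence_apply]
  refine ⟨Y, _, _, ‹_›, e, continuousLinearMapOfTendsto Tpart hTpart, (ev Set.univ).comp J,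
    existsUnique_expansion_of_biorthogonal hce hdense hbound, fun α E F hEF => ?_, hQe, ?_⟩
  · simpa only [← hJ, hJsum] using norm_sum_smul_subsumSequence_mono x α hEF
  · ext v
    refine tendsto_nhds_unique ((((ev Set.univ).comp J).continuous.tendsto _).comp
      (tendsto_pi_nhds.1 hTpart v)) ?_
    simpa [Function.comp_def, Tpart, map_sum, hQe] using hframe v (Equiv.refl ℕ)
end

section
/- Let λ ≥ 1 and let X be a Banach space with the λ-bounded approximation property: for every compact subset K ⊆ X and every ε > 0 there is a bounded finite-rank linear map F: X → X with ‖F‖ ≤ λ and ‖F(x) − x‖ < ε for all x ∈ K. Then for every separable closed subspace Y of X there exist a separable closed subspace Ỹ of X containing Y and a sequence of bounded finite-rank linear maps F_n: X → X such that ‖F_n‖ ≤ λ, F_n(Ỹ) ⊆ Ỹ for every n, and ‖F_n(y) − y‖ → 0 for every y ∈ Ỹ. In particular, Ỹ is a separable closed subspace containing Y which has the λ-bounded approximation property. -/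
open Filter

/-- The points at which a sequence of linear maps converges to the identity form a submodule. -/
def pointwiseFixedLimit {X : Type*} [NormedAddCommGroup X] [NormedSpace ℂ X]
    (F : ℕ → X →L[ℂ] X) : Submodule ℂ X where
  carrier := {x | Tendsto (fun n => F n x) atTop (nhds x)}
  zero_mem' := by simp
  add_mem' := fun {a b} (ha : Tendsto _ _ _) (hb : Tendsto _ _ _) => by
    simpa using ha.add hb
  smul_mem' := fun c x (hx : Tendsto _ _ _) => by
    simpa using hx.const_smul c

/-- A norm-bounded sequence of linear maps is equicontinuous. -/
theorem equicontinuous_of_opNorm_le {X : Type*} [NormedAddCommGroup X] [NormedSpace ℂ X]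
    {l : ℝ} (hl : 0 ≤ l) (F : ℕ → X →L[ℂ] X) (hF : ∀ n, ‖F n‖ ≤ l) :
    Equicontinuous (fun n => (F n : X → X)) := by
  refine (LipschitzWith.uniformEquicontinuous _ ⟨l, hl⟩ fun n => ?_).equicontinuous
  exact (F n).lipschitz.weaken (hF n)

/-- A norm-bounded sequence of linear maps converging pointwise to the identity converges
uniformly on compact sets. -/
theorem exists_forall_norm_sub_lt_of_isCompact {X : Type*} [NormedAddCommGroup X]
    [NormedSpace ℂ X] {l : ℝ} (hl : 0 ≤ l) (G : ℕ → X →L[ℂ] X) (hG : ∀ n, ‖G n‖ ≤ l)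
    (hlim : ∀ x, Tendsto (fun n => G n x) atTop (nhds x))
    {K : Set X} (hK : IsCompact K) {ε : ℝ} (hε : 0 < ε) :
    ∃ n, ∀ x ∈ K, ‖G n x - x‖ < ε := by
  have hδ : 0 < ε / (2 * (l + 1)) := by positivity
  obtain ⟨t, -, htfin, htK⟩ := hK.finite_cover_balls hδ
  have hev : ∀ᶠ n in atTop, ∀ x ∈ t, ‖G n x - x‖ < ε / 2 := by
    rw [htfin.eventually_all]
    intro x _
    simpa [dist_eq_norm] using (Metric.tendsto_nhds.1 (hlim x)) (ε / 2) (half_pos hε)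
  obtain ⟨n, hn⟩ := hev.exists
  refine ⟨n, fun x hx => ?_⟩
  obtain ⟨y, hy, hxy⟩ := Set.mem_iUnion₂.1 (htK hx)
  rw [Metric.mem_ball, dist_eq_norm] at hxy
  have hGxy : ‖G n (x - y)‖ ≤ l * ‖x - y‖ := (G n).le_of_opNorm_le (hG n) _
  have hsum : (l + 1) * ‖x - y‖ < ε / 2 := by
    rw [lt_div_iff₀ (by positivity)] at hxy
    linarith
  calc ‖G n x - x‖ = ‖G n (x - y) + (G n y - y) - (x - y)‖ := by
        rw [map_sub]; congr 1; abel
    _ ≤ ‖G n (x - y)‖ + ‖G n y - y‖ + ‖x - y‖ :=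
        (norm_sub_le _ _).trans (by gcongr; exact norm_add_le _ _)
    _ < ε := by linarith [hn y hy]

/-- The restriction of a finite-rank map to an invariant subspace has finite rank. -/
theorem finiteDimensional_range_restrict {V : Type*} [AddCommGroup V] [Module ℂ V]
    (f : V →ₗ[ℂ] V) [FiniteDimensional ℂ (LinearMap.range f)] (Z : Submodule ℂ V)
    (hZ : ∀ z ∈ Z, f z ∈ Z) : FiniteDimensional ℂ (LinearMap.range (f.restrict hZ)) := by
  refine Module.Finite.of_injective
    ((Z.subtype.domRestrict (LinearMap.range (f.restrict hZ))).codRestrict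
      (LinearMap.range f) ?_) ?_
  · rintro ⟨_, z, rfl⟩
    exact ⟨z, rfl⟩
  · intro a b hab
    exact Subtype.ext (Subtype.ext (congrArg (LinearMap.range f).subtype hab))

/-- Under the bounded approximation property, one can build a sequence of finite-rank maps and an
increasing sequence of finite sets such that the `n`-th map is nearly the identity on the `n`-th
set, while its range is spanned by elements of the next set, which also absorbs the `n`-th term of
a given sequence. -/
theorem exists_finiteRank_seq {X : Type*} [NormedAddCommGroup X] [NormedSpace ℂ X] (l : ℝ)
    (hBAP : ∀ K : Set X, IsCompact K → ∀ ε : ℝ, 0 < ε →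
      ∃ F : X →L[ℂ] X, FiniteDimensional ℂ (LinearMap.range (F : X →ₗ[ℂ] X)) ∧
        ‖F‖ ≤ l ∧ ∀ x ∈ K, ‖F x - x‖ < ε) (y : ℕ → X) :
    ∃ (F : ℕ → X →L[ℂ] X) (S : ℕ → Finset X), Monotone S ∧ (∀ n, y n ∈ S (n + 1)) ∧
      (∀ n, FiniteDimensional ℂ (LinearMap.range (F n : X →ₗ[ℂ] X))) ∧ (∀ n, ‖F n‖ ≤ l) ∧
      (∀ n, LinearMap.range (F n : X →ₗ[ℂ] X) ≤ Submodule.span ℂ (S (n + 1) : Set X)) ∧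
      ∀ n, ∀ x ∈ S n, ‖F n x - x‖ < 1 / ((n : ℝ) + 1) := by
  classical
  choose F hfin hnorm happrox using fun (T : Finset X) (n : ℕ) =>
    hBAP T T.finite_toSet.isCompact (1 / ((n : ℝ) + 1)) (by positivity)
  choose B hB using fun (T : Finset X) (n : ℕ) => Module.Finite.iff_fg.1 (hfin T n)
  let S : ℕ → Finset X := fun n => Nat.rec ∅ (fun k T => insert (y k) (T ∪ B T k)) n
  have hS : ∀ n, S (n + 1) = insert (y n) (S n ∪ B (S n) n) := fun _ => rfl
  refine ⟨fun n => F (S n) n, S, monotone_nat_of_le_succ fun n => ?_, fun n => ?_,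
    fun n => hfin _ _, fun n => hnorm _ _, fun n => ?_, fun n x hx => happrox _ _ x hx⟩
  · rw [hS]
    exact Finset.subset_union_left.trans (Finset.subset_insert _ _)
  · rw [hS]
    exact Finset.mem_insert_self _ _
  · rw [← hB (S n) n, hS]
    exact Submodule.span_mono
      (Finset.coe_subset.2 (Finset.subset_union_right.trans (Finset.subset_insert _ _)))

/-- If a Banach space `X` has the `λ`-bounded approximation property, then every separable
closed subspace `Y` of `X` is contained in a separable closed subspace `Ỹ` of `X` which is
invariant under a sequence of finite-rank maps `F_n` on `X` with `‖F_n‖ ≤ λ` converging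
pointwise to the identity on `Ỹ`; in particular `Ỹ` has the `λ`-bounded approximation
property. -/
theorem separable_subspace_lambda_bap
    {X : Type*} [NormedAddCommGroup X] [NormedSpace ℂ X] [CompleteSpace X]
    (l : ℝ) (hl : 1 ≤ l)
    (hBAP : ∀ K : Set X, IsCompact K → ∀ ε : ℝ, 0 < ε →
      ∃ F : X →L[ℂ] X, FiniteDimensional ℂ (LinearMap.range (F : X →ₗ[ℂ] X)) ∧
        ‖F‖ ≤ l ∧ ∀ x ∈ K, ‖F x - x‖ < ε)
    (Y : Submodule ℂ X) (hYclosed : IsClosed (Y : Set X))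
    (hYsep : TopologicalSpace.SeparableSpace Y) :
    ∃ Z : Submodule ℂ X,
      IsClosed (Z : Set X) ∧
      TopologicalSpace.SeparableSpace Z ∧
      Y ≤ Z ∧
      (∃ F : ℕ → X →L[ℂ] X,
        (∀ n, FiniteDimensional ℂ (LinearMap.range (F n : X →ₗ[ℂ] X))) ∧
        (∀ n, ‖F n‖ ≤ l) ∧
        (∀ n, ∀ z ∈ Z, F n z ∈ Z) ∧
        (∀ z ∈ Z, Tendsto (fun n => F n z) atTop (nhds z))) ∧
      -- in particular, `Z` has the `λ`-bounded approximation property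
      (∀ K : Set Z, IsCompact K → ∀ ε : ℝ, 0 < ε →
        ∃ G : Z →L[ℂ] Z, FiniteDimensional ℂ (LinearMap.range (G : Z →ₗ[ℂ] Z)) ∧
          ‖G‖ ≤ l ∧ ∀ z ∈ K, ‖G z - z‖ < ε) := by
  have hl0 : 0 ≤ l := zero_le_one.trans hl
  obtain ⟨F, S, hmono, hyS, hfin, hnorm, hrange, happrox⟩ :=
    exists_finiteRank_seq l hBAP fun n => (TopologicalSpace.denseSeq Y n : X)
  let W : Submodule ℂ X := Submodule.span ℂ (⋃ n, (S n : Set X))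
  have hWsub : ∀ n, Submodule.span ℂ (S n : Set X) ≤ W := fun n =>
    Submodule.span_mono (Set.subset_iUnion (fun n => (S n : Set X)) n)
  have hsep : TopologicalSpace.SeparableSpace W.topologicalClosure := by
    have hcount : (⋃ n, (S n : Set X)).Countable :=
      Set.countable_iUnion fun n => (S n).countable_toSet
    exact hcount.isSeparable.span.closure.separableSpace
  have hYZ : Y ≤ W.topologicalClosure := by
    intro y hy
    have hdense := TopologicalSpace.denseRange_denseSeq Y ⟨y, hy⟩
    have hmem := image_closure_subset_closure_image continuous_subtype_val
      (Set.mem_image_of_mem Subtype.val hdense)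
    refine closure_mono ?_ hmem
    rintro _ ⟨_, ⟨n, rfl⟩, rfl⟩
    exact hWsub (n + 1) (Submodule.subset_span (hyS n))
  have hinv : ∀ n, ∀ z ∈ W.topologicalClosure, F n z ∈ W.topologicalClosure := fun n z _ =>
    W.le_topologicalClosure (hWsub (n + 1) (hrange n ⟨z, rfl⟩))
  have hlim : ∀ z ∈ W.topologicalClosure, Tendsto (fun n => F n z) atTop (nhds z) := by
    have hclosed : IsClosed (pointwiseFixedLimit F : Set X) :=
      (equicontinuous_of_opNorm_le hl0 F hnorm).isClosed_setOfPred_tendsto continuous_id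
    have hle : W ≤ pointwiseFixedLimit F := by
      refine Submodule.span_le.2 (Set.iUnion_subset fun m x hx => ?_)
      refine tendsto_iff_norm_sub_tendsto_zero.2 ?_
      refine squeeze_zero' (Eventually.of_forall fun n => norm_nonneg _) ?_
        tendsto_one_div_add_atTop_nhds_zero_nat
      filter_upwards [eventually_ge_atTop m] with n hn
      exact (happrox n x (hmono hn hx)).le
    exact fun z hz => W.topologicalClosure_minimal hle hclosed hz
  refine ⟨W.topologicalClosure, W.isClosed_topologicalClosure, hsep, hYZ,
    ⟨F, hfin, hnorm, hinv, hlim⟩, fun K hK ε hε => ?_⟩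
  let G : ℕ → W.topologicalClosure →L[ℂ] W.topologicalClosure := fun n =>
    ((F n).comp W.topologicalClosure.subtypeL).codRestrict W.topologicalClosure
      fun z => hinv n z z.2
  have hG : ∀ n, ‖G n‖ ≤ l := fun n =>
    (G n).opNorm_le_bound hl0 fun z => (F n).le_of_opNorm_le (hnorm n) z
  obtain ⟨n, hn⟩ := exists_forall_norm_sub_lt_of_isCompact hl0 G hG
    (fun z => tendsto_subtype_rng.2 (hlim z z.2)) hK hε
  have := hfin n
  exact ⟨G n, finiteDimensional_range_restrict (F n : X →ₗ[ℂ] X) _ (hinv n), hG n, hn⟩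
end
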